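/- arXiv:1501.07167 — 3 statements merged into one kernel-verified Lean document; each statement's English description precedes it below -/
import Mathlib

section
/- (Comparison principle.) Let Ω be a bounded domain of ℂⁿ and T ∈ (0,∞]. Let u, v ∈ C^∞(Ω×(0,T)) ∩ C(Ω̄×[0,T)) be such that u(·,t) and v(·,t) are strictly plurisubharmonic for every t ∈ [0,T), ∂u/∂t ≤ log det(u_{αβ̄}) + f(t,z,u), and ∂v/∂t ≥ log det(v_{αβ̄}) + f(t,z,v), where f ∈ C^∞([0,T)×Ω̄×ℝ) is non increasing in the last variable. Then sup over Ω×(0,T) of (u − v) is at most max{0, sup over ∂_P(Ω×(0,T)) of (u − v)}. -/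
open Set Metric Complex Topology Filter Bornology
open scoped ComplexOrder

noncomputable section

/-- `ℂⁿ` with its Euclidean structure. -/
abbrev Cn (n : ℕ) := EuclideanSpace ℂ (Fin n)

/-- The `α`-th coordinate vector scaled by `c`. -/
def cvec (n : ℕ) (α : Fin n) (c : ℂ) : Cn n := EuclideanSpace.single α c

variable {n : ℕ}

/-- Wirtinger derivative `∂/∂z_α` (within a set), via the real Fréchet derivative. -/
def wderW (s : Set (Cn n)) (α : Fin n) (u : Cn n → ℂ) (z : Cn n) : ℂ :=
  (fderivWithin ℝ u s z (cvec n α 1) - Complex.I * fderivWithin ℝ u s z (cvec n α Complex.I)) / 2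

/-- Conjugate Wirtinger derivative `∂/∂z̄_β` (within a set). -/
def wderBarW (s : Set (Cn n)) (β : Fin n) (u : Cn n → ℂ) (z : Cn n) : ℂ :=
  (fderivWithin ℝ u s z (cvec n β 1) + Complex.I * fderivWithin ℝ u s z (cvec n β Complex.I)) / 2

/-- The complex Hessian matrix `u_{αβ̄} = ∂²u/∂z_α ∂z̄_β` of a real valued function,
computed within a set `s`. -/
def cHessW (s : Set (Cn n)) (u : Cn n → ℝ) (z : Cn n) : Matrix (Fin n) (Fin n) ℂ :=
  Matrix.of fun α β => wderW s α (wderBarW s β fun w => (u w : ℂ)) z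

/-- The complex Hessian matrix `u_{αβ̄}`. -/
def cHess (u : Cn n → ℝ) : Cn n → Matrix (Fin n) (Fin n) ℂ := cHessW univ u

/-- The Euclidean Laplacian (within a set) of `v : ℂⁿ → ℝ`, i.e. the sum of all pure second
derivatives in the `2n` underlying real coordinate directions. -/
def lapW (s : Set (Cn n)) (v : Cn n → ℝ) (z : Cn n) : ℝ :=
  ∑ α : Fin n,
    (fderivWithin ℝ (fun y => fderivWithin ℝ v s y (cvec n α 1)) s z (cvec n α 1) +
      fderivWithin ℝ (fun y => fderivWithin ℝ v s y (cvec n α Complex.I)) s z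
        (cvec n α Complex.I))

/-- The Euclidean Laplacian of `v : ℂⁿ → ℝ`. -/
def lap (v : Cn n → ℝ) : Cn n → ℝ := lapW univ v

/-- A bounded smooth strictly pseudoconvex domain of `ℂⁿ`: a bounded (nonempty) domain with a
smooth strictly plurisubharmonic defining function `ρ` on a bounded neighbourhood of its closure,
with nonvanishing differential on the boundary. -/
def IsSPCDomain (Ω : Set (Cn n)) : Prop :=
  IsOpen Ω ∧ Ω.Nonempty ∧ IsBounded Ω ∧
    ∃ (U : Set (Cn n)) (ρ : Cn n → ℝ), IsOpen U ∧ IsBounded U ∧ closure Ω ⊆ U ∧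
      ContDiffOn ℝ (⊤ : ℕ∞) ρ U ∧ (∀ z ∈ U, (cHess ρ z).PosDef) ∧
      Ω = {z ∈ U | ρ z < 0} ∧ ∀ z ∈ frontier Ω, fderiv ℝ ρ z ≠ 0

open scoped ENNReal

/-- The real interval `(0,T)` for an extended real `T ∈ (0,∞]`. -/
def iooT (T : ℝ≥0∞) : Set ℝ := {t : ℝ | 0 < t ∧ ENNReal.ofReal t < T}

/-- The real interval `[0,T)` for an extended real `T ∈ (0,∞]`. -/
def icoT (T : ℝ≥0∞) : Set ℝ := {t : ℝ | 0 ≤ t ∧ ENNReal.ofReal t < T}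

open scoped MatrixOrder Matrix in
theorem det_one_add_ge {m : ℕ} {Q : Matrix (Fin m) (Fin m) ℂ} (hQ : Q.PosSemidef) :
    (1 : ℂ) ≤ (1 + Q).det := by
  have hs := hQ.1.spectral_theorem
  have hU := (Matrix.mem_unitaryGroup_iff (A := (hQ.1.eigenvectorUnitary : Matrix (Fin m) (Fin m) ℂ))).1
    hQ.1.eigenvectorUnitary.2
  have hU' := (Matrix.mem_unitaryGroup_iff' (A := (hQ.1.eigenvectorUnitary : Matrix (Fin m) (Fin m) ℂ))).1
    hQ.1.eigenvectorUnitary.2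
  rw [Unitary.conjStarAlgAut_apply] at hs
  set U := (hQ.1.eigenvectorUnitary : Matrix (Fin m) (Fin m) ℂ)
  have h1 : 1 + Q = U * (1 + Matrix.diagonal (RCLike.ofReal ∘ hQ.1.eigenvalues)) * star U := by
    rw [mul_add, add_mul, mul_one, hU]
    congr 1
  have h2 : (1 + Q).det = ∏ i, (1 + (hQ.1.eigenvalues i : ℂ)) := by
    rw [h1, Matrix.det_mul_comm, ← mul_assoc, hU', one_mul, ← Matrix.diagonal_one,
      Matrix.diagonal_add, Matrix.det_diagonal]
    rfl
  rw [h2]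
  have h3 : (1 : ℝ) ≤ ∏ i, (1 + hQ.1.eigenvalues i) := by
    calc (1 : ℝ) = ∏ i : Fin m, (1 : ℝ) := by simp
      _ ≤ _ := Finset.prod_le_prod (fun _ _ => zero_le_one) fun i _ => by
        have := hQ.eigenvalues_nonneg i
        linarith
  have : ((1:ℝ):ℂ) ≤ ((∏ i, (1 + hQ.1.eigenvalues i) : ℝ) : ℂ) := by exact_mod_cast h3
  simpa using this

open scoped MatrixOrder Matrix in
theorem det_re_mono {m : ℕ} {A B : Matrix (Fin m) (Fin m) ℂ} (hA : A.PosDef)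
    (hAB : (B - A).PosSemidef) : 0 < A.det.re ∧ A.det.re ≤ B.det.re := by
  have hd := hA.det_pos
  have hd' := Complex.lt_def.1 hd
  refine ⟨by simpa using hd'.1, ?_⟩
  obtain ⟨C, hC⟩ : ∃ C : Matrix (Fin m) (Fin m) ℂ, A = star C * C :=
    CStarAlgebra.nonneg_iff_eq_star_mul_self.1 (Matrix.nonneg_iff_posSemidef.2 hA.posSemidef)
  rw [Matrix.star_eq_conjTranspose] at hC
  have hCu : IsUnit C.det := by
    rw [isUnit_iff_ne_zero]
    intro h
    rw [hC, Matrix.det_mul, h, mul_zero] at hd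
    exact lt_irrefl _ hd
  have hQ := hAB.conjTranspose_mul_mul_same C⁻¹
  set Q := C⁻¹ᴴ * (B - A) * C⁻¹ with hQdef
  have hB : B = Cᴴ * (1 + Q) * C := by
    have e1 : Cᴴ * C⁻¹ᴴ = 1 := by
      rw [← Matrix.conjTranspose_mul, Matrix.nonsing_inv_mul _ hCu, Matrix.conjTranspose_one]
    have e2 : C⁻¹ * C = 1 := Matrix.nonsing_inv_mul _ hCu
    calc B = A + (B - A) := by abel
      _ = Cᴴ * C + (Cᴴ * C⁻¹ᴴ) * (B - A) * (C⁻¹ * C) := by rw [e1, e2, ← hC]; simp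
      _ = Cᴴ * (1 + Q) * C := by rw [hQdef]; noncomm_ring
  have hdet : B.det = A.det * (1 + Q).det := by
    rw [hB, hC]; simp only [Matrix.det_mul]; ring
  have h1 := Complex.le_def.1 (det_one_add_ge hQ)
  rw [hdet, Complex.mul_re]
  have him : A.det.im = 0 := by simpa using hd'.2.symm
  rw [him]
  simp at h1 hd'
  nlinarith

theorem second_deriv_nonpos {E : Type*} [NormedAddCommGroup E] [NormedSpace ℝ E]
    {g : E → ℝ} {z : E} (hg : ContDiffAt ℝ 2 g z) (hmax : IsLocalMax g z) (a : E) :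
    fderiv ℝ (fderiv ℝ g) z a a ≤ 0 := by
  by_contra! hpos
  have hline : ∀ s : ℝ, HasDerivAt (fun s : ℝ => z + s • a) a s := fun s => by
    simpa using ((hasDerivAt_id s).smul_const a).const_add z
  have hc : Tendsto (fun s : ℝ => z + s • a) (𝓝 0) (𝓝 z) := by
    simpa using (hline 0).continuousAt.tendsto
  have hev : ∀ᶠ w in 𝓝 z, DifferentiableAt ℝ g w := by
    filter_upwards [hg.eventually (by simp)] with w hw
    exact hw.differentiableAt (by simp)
  have hd1 : deriv (fun s : ℝ => g (z + s • a)) =ᶠ[𝓝 0] fun s => fderiv ℝ g (z + s • a) a := by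
    filter_upwards [hc.eventually hev] with s hs
    exact (hs.hasFDerivAt.comp_hasDerivAt s (hline s)).deriv
  have hB : DifferentiableAt ℝ (fderiv ℝ g) z :=
    (hg.fderiv_right (m := 1) (by norm_num)).differentiableAt (by simp)
  have hB' : HasFDerivAt (fderiv ℝ g) (fderiv ℝ (fderiv ℝ g) z) (z + (0:ℝ) • a) := by
    simpa using hB.hasFDerivAt
  have hd2 : deriv (deriv (fun s : ℝ => g (z + s • a))) 0 = fderiv ℝ (fderiv ℝ g) z a a := by
    rw [hd1.deriv_eq]
    have h5 : HasDerivAt (fun s : ℝ => fderiv ℝ g (z + s • a)) (fderiv ℝ (fderiv ℝ g) z a) 0 :=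
      hB'.comp_hasDerivAt (0:ℝ) (hline 0)
    have h6 := h5.clm_apply (hasDerivAt_const (0:ℝ) a)
    rw [h6.deriv]
    simp
  have hmax' : IsLocalMax (fun s : ℝ => g (z + s • a)) 0 := by
    have := hc.eventually hmax
    simpa [IsLocalMax, IsMaxFilter] using this
  have hcont : ContinuousAt (fun s : ℝ => g (z + s • a)) 0 := by
    have : ContinuousAt g (z + (0:ℝ) • a) := by simpa using hg.continuousAt
    exact ContinuousAt.comp (g := g) this (hline 0).continuousAt
  have hmin := isLocalMin_of_deriv_deriv_pos (hd2 ▸ hpos) hmax'.deriv_eq_zero hcont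
  have hconst : (fun s : ℝ => g (z + s • a)) =ᶠ[𝓝 0] fun _ => g (z + (0:ℝ) • a) := by
    filter_upwards [hmin, hmax'] with s h1 h2
    exact le_antisymm h2 h1
  have : deriv (deriv (fun s : ℝ => g (z + s • a))) 0 = 0 := by
    rw [hconst.deriv.deriv_eq]; simp
  linarith

/-- The Levi form attached to a real bilinear form. -/
def leviL (B : Cn n →L[ℝ] Cn n →L[ℝ] ℝ) (a b : Cn n) : ℂ :=
  (((B a b : ℝ) : ℂ) + Complex.I * ((B a (Complex.I • b) : ℝ) : ℂ)
    - Complex.I * (((B (Complex.I • a) b : ℝ) : ℂ)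
      + Complex.I * ((B (Complex.I • a) (Complex.I • b) : ℝ) : ℂ))) / 4

theorem leviL_sum_left (B : Cn n →L[ℝ] Cn n →L[ℝ] ℝ) {ι : Type*} (s : Finset ι) (x : ι → Cn n)
    (b : Cn n) : leviL B (∑ i ∈ s, x i) b = ∑ i ∈ s, leviL B (x i) b := by
  simp only [leviL, Finset.smul_sum, map_sum, _root_.sum_apply,
    Complex.ofReal_sum, Finset.mul_sum, ← Finset.sum_add_distrib, ← Finset.sum_sub_distrib,
    Finset.sum_div]

theorem leviL_sum_right (B : Cn n →L[ℝ] Cn n →L[ℝ] ℝ) {ι : Type*} (s : Finset ι) (x : ι → Cn n)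
    (b : Cn n) : leviL B b (∑ i ∈ s, x i) = ∑ i ∈ s, leviL B b (x i) := by
  simp only [leviL, Finset.smul_sum, map_sum, _root_.sum_apply,
    Complex.ofReal_sum, Finset.mul_sum, ← Finset.sum_add_distrib, ← Finset.sum_sub_distrib,
    Finset.sum_div]

theorem csmul_eq (c : ℂ) (a : Cn n) : c • a = c.re • a + c.im • (Complex.I • a) := by
  ext i
  simp only [PiLp.smul_apply, PiLp.add_apply, smul_eq_mul, Complex.real_smul]
  nth_rewrite 1 [← Complex.re_add_im c]
  ring

theorem Icsmul_eq (c : ℂ) (a : Cn n) :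
    Complex.I • (c • a) = c.re • (Complex.I • a) - c.im • a := by
  ext i
  simp only [PiLp.smul_apply, PiLp.sub_apply, smul_eq_mul, Complex.real_smul]
  nth_rewrite 1 [← Complex.re_add_im c]
  linear_combination (c.im * a.ofLp i) * Complex.I_mul_I

theorem leviL_smul_left (B : Cn n →L[ℝ] Cn n →L[ℝ] ℝ) (c : ℂ) (a b : Cn n) :
    leviL B (c • a) b = c * leviL B a b := by
  simp only [leviL]
  rw [Icsmul_eq, csmul_eq c a]
  simp only [map_add, map_sub, map_smul, _root_.add_apply,
    _root_.sub_apply, _root_.smul_apply, smul_eq_mul]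
  conv_rhs => rw [← Complex.re_add_im c]
  apply Complex.ext <;> simp <;> ring

theorem leviL_smul_right (B : Cn n →L[ℝ] Cn n →L[ℝ] ℝ) (c : ℂ) (a b : Cn n) :
    leviL B a (c • b) = (starRingEnd ℂ) c * leviL B a b := by
  simp only [leviL]
  rw [Icsmul_eq, csmul_eq c b]
  simp only [map_add, map_sub, map_smul, _root_.add_apply,
    _root_.sub_apply, _root_.smul_apply, smul_eq_mul]
  apply Complex.ext <;> simp <;> ring

theorem cvec_one_smul (α : Fin n) (c : ℂ) : cvec n α c = c • cvec n α 1 := by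
  ext i
  by_cases h : i = α <;> simp [cvec, h]

theorem cn_decomp (a : Cn n) : a = ∑ α, a α • cvec n α 1 := by
  ext i
  simp [cvec, Finset.sum_apply, Pi.single_apply]

theorem leviL_expand (B : Cn n →L[ℝ] Cn n →L[ℝ] ℝ) (a : Cn n) :
    leviL B a a = ∑ α, ∑ β, a α * ((starRingEnd ℂ) (a β) * leviL B (cvec n α 1) (cvec n β 1)) := by
  conv_lhs => rw [cn_decomp a]
  simp only [leviL_sum_left, leviL_sum_right, leviL_smul_left, leviL_smul_right, Finset.mul_sum]
  rw [Finset.sum_comm]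
  refine Finset.sum_congr rfl fun α _ => Finset.sum_congr rfl fun β _ => ?_
  ring

theorem cHess_eq {g : Cn n → ℝ} {z : Cn n} (hg : ContDiffAt ℝ 2 g z) (α β : Fin n) :
    cHess g z α β = leviL (fderiv ℝ (fderiv ℝ g) z) (cvec n α 1) (cvec n β 1) := by
  have hev : ∀ᶠ w in 𝓝 z, DifferentiableAt ℝ g w := by
    filter_upwards [hg.eventually (by simp)] with w hw
    exact hw.differentiableAt (by simp)
  have hB : DifferentiableAt ℝ (fderiv ℝ g) z :=
    (hg.fderiv_right (m := 1) (by norm_num)).differentiableAt (by simp)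
  have h1 : wderBarW univ β (fun w => (g w : ℂ)) =ᶠ[𝓝 z] fun w =>
      (((fderiv ℝ g w (cvec n β 1) : ℝ) : ℂ)
        + Complex.I * ((fderiv ℝ g w (cvec n β Complex.I) : ℝ) : ℂ)) / 2 := by
    filter_upwards [hev] with w hw
    have : HasFDerivAt (fun w => (g w : ℂ)) (Complex.ofRealCLM.comp (fderiv ℝ g w)) w :=
      Complex.ofRealCLM.hasFDerivAt.comp w hw.hasFDerivAt
    simp only [wderBarW, fderivWithin_univ, this.fderiv]
    rfl
  have h2 : ∀ b : Cn n, HasFDerivAt (fun w => ((fderiv ℝ g w b : ℝ) : ℂ))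
      (Complex.ofRealCLM.comp ((fderiv ℝ (fderiv ℝ g) z).flip b)) z := fun b => by
    have := hB.hasFDerivAt.clm_apply (hasFDerivAt_const b z)
    have h3 := Complex.ofRealCLM.hasFDerivAt.comp z this
    refine HasFDerivAt.congr_fderiv h3 ?_
    rw [ContinuousLinearMap.comp_zero, zero_add]
  have h3 := ((h2 (cvec n β 1)).add ((h2 (cvec n β Complex.I)).const_mul Complex.I)).mul_const
    ((2:ℂ)⁻¹)
  have h4 : HasFDerivAt (wderBarW univ β (fun w => (g w : ℂ))) _ z :=
    h3.congr_of_eventuallyEq (by simpa [div_eq_mul_inv] using h1)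
  show wderW univ α (wderBarW univ β (fun w => (g w : ℂ))) z = _
  simp only [wderW, fderivWithin_univ, h4.fderiv]
  rw [cvec_one_smul α Complex.I, cvec_one_smul β Complex.I]
  simp [leviL]
  ring

theorem leviL_diag {g : Cn n → ℝ} {z : Cn n} (hg : ContDiffAt ℝ 2 g z) (a : Cn n) :
    leviL (fderiv ℝ (fderiv ℝ g) z) a a =
      (((fderiv ℝ (fderiv ℝ g) z a a + fderiv ℝ (fderiv ℝ g) z (Complex.I • a) (Complex.I • a)) / 4
        : ℝ) : ℂ) := by
  have := hg.isSymmSndFDerivAt (by simp) a (Complex.I • a)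
  simp only [leviL, this]
  push_cast
  linear_combination (-(((fderiv ℝ (fderiv ℝ g) z) (Complex.I • a) (Complex.I • a) : ℝ) : ℂ) / 4)
    * Complex.I_mul_I

theorem cHess_sub_posSemidef {u v : Cn n → ℝ} {z : Cn n} (hu : ContDiffAt ℝ 2 u z)
    (hv : ContDiffAt ℝ 2 v z) (hmax : IsLocalMax (fun w => u w - v w) z)
    (hpu : (cHess u z).PosDef) (hpv : (cHess v z).PosDef) :
    (cHess v z - cHess u z).PosSemidef := by
  refine Matrix.PosSemidef.of_dotProduct_mulVec_nonneg (hpv.1.sub hpu.1) fun x => ?_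
  have hg : ContDiffAt ℝ 2 (fun w => u w - v w) z := hu.sub hv
  set a : Cn n := WithLp.toLp 2 (fun i => star (x i)) with ha
  have key : ∀ g : Cn n → ℝ, ContDiffAt ℝ 2 g z →
      star x ⬝ᵥ (cHess g z).mulVec x = leviL (fderiv ℝ (fderiv ℝ g) z) a a := by
    intro g hg
    rw [leviL_expand]
    simp only [dotProduct, Matrix.mulVec, Finset.mul_sum, cHess_eq hg]
    refine Finset.sum_congr rfl fun α _ => Finset.sum_congr rfl fun β _ => ?_
    rw [show a.ofLp α = star (x α) from rfl, show a.ofLp β = star (x β) from rfl,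
      Pi.star_apply, starRingEnd_apply, star_star]
    ring
  have hs : fderiv ℝ (fderiv ℝ (fun w => u w - v w)) z
      = fderiv ℝ (fderiv ℝ u) z - fderiv ℝ (fderiv ℝ v) z := by
    have hdu : DifferentiableAt ℝ (fderiv ℝ u) z :=
      (hu.fderiv_right (m := 1) (by norm_num)).differentiableAt (by simp)
    have hdv : DifferentiableAt ℝ (fderiv ℝ v) z :=
      (hv.fderiv_right (m := 1) (by norm_num)).differentiableAt (by simp)
    have : fderiv ℝ (fun w => u w - v w) =ᶠ[𝓝 z] fun w => fderiv ℝ u w - fderiv ℝ v w := by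
      filter_upwards [hu.eventually (by simp), hv.eventually (by simp)] with w h1 h2
      exact fderiv_fun_sub (h1.differentiableAt (by simp)) (h2.differentiableAt (by simp))
    rw [this.fderiv_eq, fderiv_fun_sub hdu hdv]
  rw [Matrix.sub_mulVec, dotProduct_sub, key u hu, key v hv, leviL_diag hu, leviL_diag hv,
    ← Complex.ofReal_sub]
  have h1 := second_deriv_nonpos hg hmax a
  have h2 := second_deriv_nonpos hg hmax (Complex.I • a)
  rw [hs] at h1 h2
  simp only [_root_.sub_apply] at h1 h2
  have : (0:ℝ) ≤ ((fderiv ℝ (fderiv ℝ v) z a a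
      + fderiv ℝ (fderiv ℝ v) z (Complex.I • a) (Complex.I • a)) / 4
    - (fderiv ℝ (fderiv ℝ u) z a a
      + fderiv ℝ (fderiv ℝ u) z (Complex.I • a) (Complex.I • a)) / 4) := by linarith
  exact_mod_cast this

theorem isOpen_iooT (T : ℝ≥0∞) : IsOpen (iooT T) :=
  (isOpen_lt continuous_const continuous_id).inter
    (isOpen_lt ENNReal.continuous_ofReal continuous_const)

theorem stmt_3 (n : ℕ) (Ω : Set (Cn n)) (T : ℝ≥0∞)
    (hΩo : IsOpen Ω) (hΩne : Ω.Nonempty) (hΩb : IsBounded Ω) (hT : 0 < T)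
    (f : ℝ × Cn n × ℝ → ℝ)
    (hf : ContDiffOn ℝ (⊤ : ℕ∞) f (icoT T ×ˢ closure Ω ×ˢ (univ : Set ℝ)))
    (hmono : ∀ t ∈ icoT T, ∀ z ∈ closure Ω, ∀ r s : ℝ, r ≤ s → f (t, z, s) ≤ f (t, z, r))
    (u v : Cn n × ℝ → ℝ)
    (hus : ContDiffOn ℝ (⊤ : ℕ∞) u (Ω ×ˢ iooT T)) (hvs : ContDiffOn ℝ (⊤ : ℕ∞) v (Ω ×ˢ iooT T))
    (huc : ContinuousOn u (closure Ω ×ˢ icoT T))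
    (hvc : ContinuousOn v (closure Ω ×ˢ icoT T))
    (hupsh : ∀ t ∈ icoT T, ∀ z ∈ Ω, (cHess (fun w => u (w, t)) z).PosDef)
    (hvpsh : ∀ t ∈ icoT T, ∀ z ∈ Ω, (cHess (fun w => v (w, t)) z).PosDef)
    (husub : ∀ z ∈ Ω, ∀ t ∈ iooT T,
      deriv (fun s => u (z, s)) t
        ≤ Real.log ((cHess (fun w => u (w, t)) z).det.re) + f (t, z, u (z, t)))
    (hvsup : ∀ z ∈ Ω, ∀ t ∈ iooT T,
      deriv (fun s => v (z, s)) t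
        ≥ Real.log ((cHess (fun w => v (w, t)) z).det.re) + f (t, z, v (z, t))) :
    ∀ M : ℝ,
      (∀ p ∈ frontier Ω ×ˢ iooT T ∪ closure Ω ×ˢ {(0 : ℝ)}, u p - v p ≤ M) →
      ∀ z ∈ Ω, ∀ t ∈ iooT T, u (z, t) - v (z, t) ≤ max 0 M := by
  intro M hM z0 hz0 t0 ht0
  by_contra! hlt
  set m := max 0 M with hm
  obtain ⟨ε, hε, hεlt⟩ : ∃ ε > 0, ε * t0 < u (z0, t0) - v (z0, t0) - m := by
    refine ⟨(u (z0, t0) - v (z0, t0) - m) / (2 * t0), ?_, ?_⟩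
    · exact div_pos (by linarith) (by linarith [ht0.1])
    · have := ht0.1
      have h2 : (u (z0, t0) - v (z0, t0) - m) / (2 * t0) * t0
          = (u (z0, t0) - v (z0, t0) - m) / 2 := by field_simp
      rw [h2]; linarith
  have hsub : Icc 0 t0 ⊆ icoT T := fun s hs =>
    ⟨hs.1, lt_of_le_of_lt (ENNReal.ofReal_le_ofReal hs.2) ht0.2⟩
  have hsub' : ∀ s, 0 < s → s ≤ t0 → s ∈ iooT T := fun s h1 h2 =>
    ⟨h1, lt_of_le_of_lt (ENNReal.ofReal_le_ofReal h2) ht0.2⟩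
  have hK : IsCompact (closure Ω ×ˢ Icc 0 t0) :=
    (hΩb.isCompact_closure).prod isCompact_Icc
  have hcont : ContinuousOn (fun p : Cn n × ℝ => u p - v p - ε * p.2)
      (closure Ω ×ˢ Icc 0 t0) :=
    ((huc.sub hvc).mono (prod_mono le_rfl hsub)).sub (by fun_prop)
  have h0K : (z0, t0) ∈ closure Ω ×ˢ Icc 0 t0 :=
    ⟨subset_closure hz0, ht0.1.le, le_rfl⟩
  obtain ⟨⟨z1, t1⟩, ⟨hz1, ht1⟩, hmax⟩ := hK.exists_isMaxOn ⟨_, h0K⟩ hcont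
  simp only at hz1 ht1
  have hbig : m < u (z1, t1) - v (z1, t1) - ε * t1 := by
    have := hmax h0K
    simp only [mem_ofPred_eq] at this
    linarith
  have hMm : M ≤ m := le_max_right _ _
  have hm0 : 0 ≤ m := le_max_left _ _
  have ht1pos : 0 < t1 := by
    rcases ht1.1.lt_or_eq with h | h
    · exact h
    · exfalso
      have := hM (z1, t1) (Or.inr ⟨hz1, h.symm⟩)
      rw [← h] at hbig this
      linarith
  have ht1T := hsub' t1 ht1pos ht1.2
  have hεt : 0 < ε * t1 := mul_pos hε ht1pos
  have hz1Ω : z1 ∈ Ω := by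
    by_contra hn
    have hfr : z1 ∈ frontier Ω := by
      rw [hΩo.frontier_eq]; exact ⟨hz1, hn⟩
    have := hM (z1, t1) (Or.inl ⟨hfr, ht1T⟩)
    linarith
  -- spatial comparison
  have hopen : IsOpen (Ω ×ˢ iooT T) := hΩo.prod (isOpen_iooT T)
  have hu1 : ContDiffAt ℝ (⊤ : ℕ∞) u (z1, t1) := hus.contDiffAt (hopen.mem_nhds ⟨hz1Ω, ht1T⟩)
  have hv1 : ContDiffAt ℝ (⊤ : ℕ∞) v (z1, t1) := hvs.contDiffAt (hopen.mem_nhds ⟨hz1Ω, ht1T⟩)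
  have hsp : ∀ g : Cn n × ℝ → ℝ, ContDiffAt ℝ (⊤ : ℕ∞) g (z1, t1) →
      ContDiffAt ℝ 2 (fun w => g (w, t1)) z1 := fun g hg =>
    ContDiffAt.comp (g := g) (f := fun w => (w, t1)) z1 (hg.of_le (WithTop.coe_le_coe.2 (le_top : (2 : ℕ∞) ≤ ⊤)))
      (by fun_prop)
  have hlm : IsLocalMax (fun w => u (w, t1) - v (w, t1)) z1 := by
    filter_upwards [hΩo.mem_nhds hz1Ω] with w hw
    have := hmax (show (w, t1) ∈ closure Ω ×ˢ Icc 0 t0 from ⟨subset_closure hw, ht1⟩)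
    simp only [mem_ofPred_eq] at this
    linarith
  have ht1c := hsub ht1
  have hpu := hupsh t1 ht1c z1 hz1Ω
  have hpv := hvpsh t1 ht1c z1 hz1Ω
  obtain ⟨hdp, hdle⟩ := det_re_mono hpu
    (cHess_sub_posSemidef (hsp u hu1) (hsp v hv1) hlm hpu hpv)
  have hlog := Real.log_le_log hdp hdle
  -- time derivative
  have htd : ∀ g : Cn n × ℝ → ℝ, ContDiffAt ℝ (⊤ : ℕ∞) g (z1, t1) →
      HasDerivAt (fun s => g (z1, s)) (deriv (fun s => g (z1, s)) t1) t1 := fun g hg =>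
    (DifferentiableAt.comp (g := g) (f := fun s => (z1, s)) t1 (hg.differentiableAt (by simp))
      (by fun_prop)).hasDerivAt
  have hw := ((htd u hu1).sub (htd v hv1)).sub ((hasDerivAt_id t1).const_mul ε)
  have hlm2 : IsLocalMaxOn (fun s => u (z1, s) - v (z1, s) - ε * s) (Icc 0 t1) t1 := by
    apply IsMaxOn.localize
    intro s hs
    exact hmax (show (z1, s) ∈ closure Ω ×ˢ Icc 0 t0 from ⟨hz1, hs.1, hs.2.trans ht1.2⟩)
  have hcone : (0 - t1 : ℝ) ∈ posTangentConeAt (Icc 0 t1) t1 :=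
    sub_mem_posTangentConeAt_of_segment_subset (by
      rw [segment_symm, segment_eq_Icc ht1pos.le])
  have hder := hlm2.hasFDerivWithinAt_nonpos (HasDerivAt.hasFDerivAt hw).hasFDerivWithinAt hcone
  have hder' : ε ≤ deriv (fun s => u (z1, s)) t1 - deriv (fun s => v (z1, s)) t1 := by
    simp at hder
    nlinarith
  have e1 := husub z1 hz1Ω t1 ht1T
  have e2 := hvsup z1 hz1Ω t1 ht1T
  have e3 := hmono t1 ht1c z1 hz1 (v (z1, t1)) (u (z1, t1)) (by linarith)
  linarith
end
end

section
/- Let u be a smooth strictly plurisubharmonic function on an open set of ℂⁿ with Δu > 0. Then Σ_{α,β} u^{αβ̄} (log Δu)_{αβ̄} ≥ (Δ log det(u_{αβ̄})) / (Δu), where Δ is the Euclidean Laplacian, u_{αβ̄} = ∂²u/∂z_α∂z̄_β, and (u^{αβ̄}) is the transpose of the inverse of the matrix (u_{αβ̄}). -/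
open Set Metric Complex Topology Filter Bornology
open scoped ComplexOrder

noncomputable section

variable {n : ℕ}

/-- A complexified first-order derivative operator. -/
def XX (c : ℂ) (p q : Cn n) (f : Cn n → ℂ) (z : Cn n) : ℂ :=
  (fderiv ℝ f z p + c * fderiv ℝ f z q) / 2

/-- Smoothness on a set. -/
def Sm (U : Set (Cn n)) (f : Cn n → ℂ) : Prop := ContDiffOn ℝ (⊤ : ℕ∞) f U

lemma Sm.at {U : Set (Cn n)} (hU : IsOpen U) {f : Cn n → ℂ} (hf : Sm U f) {z : Cn n}
    (hz : z ∈ U) : ContDiffAt ℝ (⊤ : ℕ∞) f z := ContDiffOn.contDiffAt hf (hU.mem_nhds hz)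

lemma Sm.diff {U : Set (Cn n)} (hU : IsOpen U) {f : Cn n → ℂ} (hf : Sm U f) {z : Cn n}
    (hz : z ∈ U) : DifferentiableAt ℝ f z := (hf.at hU hz).differentiableAt (by simp)

lemma Sm.XX {U : Set (Cn n)} (hU : IsOpen U) {f : Cn n → ℂ} (hf : Sm U f) (c : ℂ) (p q : Cn n) :
    Sm U (XX c p q f) := by
  have h : ContDiffOn ℝ (⊤ : ℕ∞) (fderiv ℝ f) U := hf.fderiv_of_isOpen hU (by simp)
  unfold Sm _root_.XX
  have hp := h.clm_apply (contDiffOn_const (c := p))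
  have hq := h.clm_apply (contDiffOn_const (c := q))
  exact (hp.add (contDiffOn_const.mul hq)).div_const 2

lemma XX_congr {U : Set (Cn n)} (hU : IsOpen U) {f g : Cn n → ℂ} (h : ∀ w ∈ U, f w = g w)
    (c : ℂ) (p q : Cn n) {z : Cn n} (hz : z ∈ U) : XX c p q f z = XX c p q g z := by
  have : f =ᶠ[𝓝 z] g := Filter.eventuallyEq_of_mem (hU.mem_nhds hz) h
  simp only [XX, this.fderiv_eq]

lemma XX_mul {f g : Cn n → ℂ} {z : Cn n} (hf : DifferentiableAt ℝ f z)
    (hg : DifferentiableAt ℝ g z) (c : ℂ) (p q : Cn n) :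
    XX c p q (fun w => f w * g w) z = XX c p q f z * g z + f z * XX c p q g z := by
  simp only [XX, fderiv_fun_mul hf hg]
  simp
  ring

lemma XX_sum {ι : Type*} (s : Finset ι) {f : ι → Cn n → ℂ} {z : Cn n}
    (hf : ∀ i, DifferentiableAt ℝ (f i) z) (c : ℂ) (p q : Cn n) :
    XX c p q (fun w => ∑ i ∈ s, f i w) z = ∑ i ∈ s, XX c p q (f i) z := by
  simp only [XX, fderiv_fun_sum (fun i _ => hf i)]
  simp [Finset.mul_sum, Finset.sum_add_distrib, ← Finset.sum_div]

lemma XX_const (a : ℂ) (z : Cn n) (c : ℂ) (p q : Cn n) :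
    XX c p q (fun _ => a) z = 0 := by
  simp [XX]

lemma XX_inv {f : Cn n → ℂ} {z : Cn n} (hf : DifferentiableAt ℝ f z) (h0 : f z ≠ 0)
    (c : ℂ) (p q : Cn n) :
    XX c p q (fun w => (f w)⁻¹) z = - XX c p q f z / (f z) ^ 2 := by
  have h1 : HasFDerivAt (fun w => (f w)⁻¹) _ z :=
    HasFDerivAt.comp z (hasFDerivAt_inv' (𝕜 := ℝ) h0) hf.hasFDerivAt
  simp only [XX]
  rw [h1.fderiv]
  simp
  field_simp
  ring

lemma snd_apply {f : Cn n → ℂ} {z : Cn n} (hf : ContDiffAt ℝ (⊤ : ℕ∞) f z) (p : Cn n) :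
    HasFDerivAt (fun y => fderiv ℝ f y p) ((fderiv ℝ (fderiv ℝ f) z).flip p) z := by
  have h : DifferentiableAt ℝ (fderiv ℝ f) z :=
    (hf.fderiv_right (m := 1) (by norm_cast)).differentiableAt (by simp)
  have := h.hasFDerivAt.clm_apply (hasFDerivAt_const p z)
  simpa using this

lemma XX_XX {f : Cn n → ℂ} {z : Cn n} (hf : ContDiffAt ℝ (⊤ : ℕ∞) f z) (c c₂ : ℂ)
    (p q p₂ q₂ : Cn n) :
    XX c p q (XX c₂ p₂ q₂ f) z =
      (fderiv ℝ (fderiv ℝ f) z p p₂ + c₂ * fderiv ℝ (fderiv ℝ f) z p q₂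
      + c * (fderiv ℝ (fderiv ℝ f) z q p₂ + c₂ * fderiv ℝ (fderiv ℝ f) z q q₂)) / 4 := by
  have h : HasFDerivAt (XX c₂ p₂ q₂ f) ((2:ℂ)⁻¹ • ((fderiv ℝ (fderiv ℝ f) z).flip p₂ +
      c₂ • (fderiv ℝ (fderiv ℝ f) z).flip q₂)) z := by
    have := ((snd_apply hf p₂).add ((snd_apply hf q₂).const_mul c₂)).const_mul ((2:ℂ)⁻¹)
    refine this.congr_of_eventuallyEq (Filter.Eventually.of_forall fun w => ?_)
    simp [XX]; ring
  rw [XX, h.fderiv]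
  simp
  ring

lemma XX_comm {f : Cn n → ℂ} {z : Cn n} (hf : ContDiffAt ℝ (⊤ : ℕ∞) f z) (c c₂ : ℂ)
    (p q p₂ q₂ : Cn n) :
    XX c p q (XX c₂ p₂ q₂ f) z = XX c₂ p₂ q₂ (XX c p q f) z := by
  have hs : IsSymmSndFDerivAt ℝ f z := hf.isSymmSndFDerivAt (by simp; norm_cast)
  rw [XX_XX hf, XX_XX hf, hs p p₂, hs p q₂, hs q p₂, hs q q₂]
  ring

lemma XX_conj {f : Cn n → ℂ} {z : Cn n} (hf : DifferentiableAt ℝ f z) (c : ℂ) (p q : Cn n) :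
    XX (star c) p q (fun w => star (f w)) z = star (XX c p q f z) := by
  have h : HasFDerivAt (fun w => star (f w))
      ((Complex.conjCLE : ℂ →L[ℝ] ℂ).comp (fderiv ℝ f z)) z :=
    (Complex.conjCLE : ℂ →L[ℝ] ℂ).hasFDerivAt.comp z hf.hasFDerivAt
  simp only [XX]
  rw [h.fderiv]
  simp

lemma fderiv_ofReal {v : Cn n → ℝ} {z : Cn n} (hv : DifferentiableAt ℝ v z) (p : Cn n) :
    fderiv ℝ (fun w => (v w : ℂ)) z p = (fderiv ℝ v z p : ℂ) := by
  have h : HasFDerivAt (fun w => (v w : ℂ))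
      (Complex.ofRealCLM.comp (fderiv ℝ v z)) z :=
    Complex.ofRealCLM.hasFDerivAt.comp z hv.hasFDerivAt
  rw [h.fderiv]
  simp

lemma XX_log {v : Cn n → ℝ} {z : Cn n} (hv : DifferentiableAt ℝ v z) (h0 : v z ≠ 0)
    (c : ℂ) (p q : Cn n) :
    XX c p q (fun w => ((Real.log (v w) : ℝ) : ℂ)) z =
      (v z : ℂ)⁻¹ * XX c p q (fun w => (v w : ℂ)) z := by
  simp only [XX, fderiv_ofReal hv, fderiv_ofReal (hv.log h0), fderiv.log hv h0]
  simp
  ring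

lemma fderiv_det_apply (G : Fin n → Fin n → ℂ) (hG : IsUnit (Matrix.det (Matrix.of G)))
    (M : Fin n → Fin n → ℂ) :
    fderiv ℝ (fun A : Fin n → Fin n → ℂ => Matrix.det (Matrix.of A)) G M =
      Matrix.det (Matrix.of G) * ((Matrix.of G)⁻¹ * Matrix.of M).trace := by
  have hd : DifferentiableAt ℝ (fun A : Fin n → Fin n → ℂ => Matrix.det (Matrix.of A)) G := by
    simp only [Matrix.det_apply', Matrix.of_apply]
    fun_prop
  have h1 : HasDerivAt (fun t : ℝ => G + t • M) M 0 := by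
    simpa using ((hasDerivAt_id (0:ℝ)).smul_const M).const_add G
  have h2 := (show HasFDerivAt _ _ (G + (0:ℝ) • M) by
    simpa using hd.hasFDerivAt).comp_hasDerivAt (0:ℝ) h1
  set N := (Matrix.of G)⁻¹ * Matrix.of M with hN
  have h3 : ∀ t : ℝ, Matrix.det (Matrix.of (G + t • M)) =
      Matrix.det (Matrix.of G) * (1 + N.trace * (t:ℂ) +
        (Matrix.det (1 + (Polynomial.X : Polynomial ℂ) • N.map Polynomial.C)).divX.divX.eval (t:ℂ)
          * (t:ℂ)^2) := by
    intro t
    rw [← Matrix.det_one_add_smul, ← Matrix.det_mul, mul_add, mul_one, hN, Matrix.mul_smul,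
      ← Matrix.mul_assoc, Matrix.mul_nonsing_inv _ hG, Matrix.one_mul]
    congr 1
  set P := (Matrix.det (1 + (Polynomial.X : Polynomial ℂ) • N.map Polynomial.C)).divX.divX
  have h4 : HasDerivAt (fun t : ℝ => Matrix.det (Matrix.of G) * (1 + N.trace * (t:ℂ) +
        P.eval (t:ℂ) * (t:ℂ)^2)) (Matrix.det (Matrix.of G) * N.trace) 0 := by
    have a : HasDerivAt (fun t : ℂ => Matrix.det (Matrix.of G) * (1 + N.trace * t +
        P.eval t * t^2)) (Matrix.det (Matrix.of G) * N.trace) ((0:ℝ):ℂ) := by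
      have b := ((((hasDerivAt_id ((0:ℝ):ℂ)).const_mul N.trace).const_add 1).add
        ((P.hasDerivAt ((0:ℝ):ℂ)).mul (hasDerivAt_pow 2 ((0:ℝ):ℂ)))).const_mul
          (Matrix.det (Matrix.of G))
      simpa using b
    exact a.comp_ofReal
  have h5 := h2.unique (h4.congr_of_eventuallyEq (Filter.Eventually.of_forall h3))
  exact h5

lemma XX_det {g : Cn n → Matrix (Fin n) (Fin n) ℂ} {z : Cn n}
    (hg : ∀ i j, DifferentiableAt ℝ (fun w => g w i j) z) (h0 : IsUnit (g z).det)
    (c : ℂ) (p q : Cn n) :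
    XX c p q (fun w => (g w).det) z =
      (g z).det * ((g z)⁻¹ * Matrix.of fun i j => XX c p q (fun w => g w i j) z).trace := by
  have hd : DifferentiableAt ℝ (fun A : Fin n → Fin n → ℂ => Matrix.det (Matrix.of A))
      (fun i j => g z i j) := by
    simp only [Matrix.det_apply', Matrix.of_apply]
    fun_prop
  have hG : HasFDerivAt (fun w => (fun i j => g w i j : Fin n → Fin n → ℂ))
      (ContinuousLinearMap.pi fun i => ContinuousLinearMap.pi fun j =>
        fderiv ℝ (fun w => g w i j) z) z := by
    rw [hasFDerivAt_pi]
    intro i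
    rw [hasFDerivAt_pi]
    intro j
    exact (hg i j).hasFDerivAt
  have h1 : HasFDerivAt (fun w => (g w).det) _ z :=
    HasFDerivAt.comp (g := fun A : Fin n → Fin n → ℂ => Matrix.det (Matrix.of A)) z
      hd.hasFDerivAt hG
  have key : ∀ v, fderiv ℝ (fun w => (g w).det) z v = (g z).det *
      ((g z)⁻¹ * Matrix.of fun i j => fderiv ℝ (fun w => g w i j) z v).trace := by
    intro v
    rw [h1.fderiv]
    exact fderiv_det_apply (fun i j => g z i j) h0 _
  simp only [XX]
  rw [key, key]
  simp only [Matrix.trace, Matrix.diag, Matrix.mul_apply, Matrix.of_apply, Finset.mul_sum,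
    ← Finset.sum_add_distrib, Finset.sum_div]
  refine Finset.sum_congr rfl fun i _ => Finset.sum_congr rfl fun j _ => ?_
  ring

lemma Sm.inv_entry {U : Set (Cn n)} {g : Cn n → Matrix (Fin n) (Fin n) ℂ}
    (hg : ∀ i j, Sm U (fun w => g w i j)) (h0 : ∀ w ∈ U, (g w).det ≠ 0) (i j : Fin n) :
    Sm U (fun w => (g w)⁻¹ i j) := by
  have hdet : ∀ (k : Cn n → Matrix (Fin n) (Fin n) ℂ), (∀ i j, Sm U (fun w => k w i j)) →
      Sm U (fun w => (k w).det) := by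
    intro k hk
    unfold Sm at *
    simp only [Matrix.det_apply']
    refine ContDiffOn.sum fun σ _ => contDiffOn_const.mul ?_
    exact contDiffOn_prod fun i _ => hk _ _
  have h : ∀ w, (g w)⁻¹ i j = ((g w).det)⁻¹ * ((g w).updateRow j (Pi.single i 1)).det := by
    intro w
    rw [Matrix.inv_def, Matrix.smul_apply, Matrix.adjugate_apply, Ring.inverse_eq_inv', smul_eq_mul]
  simp only [h]
  refine ContDiffOn.mul ((hdet g hg).inv h0) (hdet _ ?_)
  intro a b
  by_cases hab : a = j
  · subst hab
    simp only [Matrix.updateRow_self]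
    exact contDiffOn_const
  · simp only [Matrix.updateRow_ne hab]
    exact hg a b

lemma XX_minv {U : Set (Cn n)} (hU : IsOpen U) {g : Cn n → Matrix (Fin n) (Fin n) ℂ}
    (hg : ∀ i j, Sm U (fun w => g w i j)) (h0 : ∀ w ∈ U, (g w).det ≠ 0)
    (c : ℂ) (p q : Cn n) {z : Cn n} (hz : z ∈ U) :
    (Matrix.of fun i j => XX c p q (fun w => (g w)⁻¹ i j) z) =
      -((g z)⁻¹ * (Matrix.of fun i j => XX c p q (fun w => g w i j) z) * (g z)⁻¹) := by
  have hi := fun i j => Sm.inv_entry hg h0 i j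
  set H := (Matrix.of fun i j => XX c p q (fun w => (g w)⁻¹ i j) z) with hH
  set K := (Matrix.of fun i j => XX c p q (fun w => g w i j) z) with hK
  have hu := (h0 z hz).isUnit
  have key : H * g z + (g z)⁻¹ * K = 0 := by
    ext i j
    have e1 : XX c p q (fun w => ∑ k, (g w)⁻¹ i k * g w k j) z =
        XX c p q (fun _ => (1 : Matrix (Fin n) (Fin n) ℂ) i j) z := by
      refine XX_congr hU (fun w hw => ?_) c p q hz
      rw [← Matrix.mul_apply, Matrix.nonsing_inv_mul _ (h0 w hw).isUnit]
    rw [XX_const, XX_sum (f := fun k w => (g w)⁻¹ i k * g w k j) _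
      (fun k => ((hi i k).diff hU hz).mul ((hg k j).diff hU hz))] at e1
    simp only [Matrix.add_apply, Matrix.mul_apply, ← Finset.sum_add_distrib, Matrix.zero_apply]
    rw [← e1]
    refine Finset.sum_congr rfl fun k _ => ?_
    rw [XX_mul ((hi i k).diff hU hz) ((hg k j).diff hU hz)]
    simp [hH, hK]
  have : H * g z * (g z)⁻¹ = -((g z)⁻¹ * K) * (g z)⁻¹ := by
    rw [eq_neg_of_add_eq_zero_left key]
  rw [Matrix.mul_assoc, Matrix.mul_nonsing_inv _ hu, Matrix.mul_one] at this
  rw [this, Matrix.neg_mul]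

lemma trace_sandwich_nonneg {h : Matrix (Fin n) (Fin n) ℂ} (hh : h.PosSemidef)
    (C : Matrix (Fin n) (Fin n) ℂ) : 0 ≤ (h * C * h * C.conjTranspose).trace := by
  have h1 : (C * h * C.conjTranspose).PosSemidef := hh.mul_mul_conjTranspose_same C
  obtain ⟨B, hB⟩ : ∃ B : Matrix (Fin n) (Fin n) ℂ, h = B.conjTranspose * B := by
    open scoped MatrixOrder in
    obtain ⟨B, hB⟩ := CStarAlgebra.nonneg_iff_eq_star_mul_self.mp hh.nonneg
    exact ⟨B, hB⟩
  have h2 : (h * C * h * C.conjTranspose).trace =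
      (B * (C * h * C.conjTranspose) * B.conjTranspose).trace := by
    rw [Matrix.trace_mul_comm _ B.conjTranspose, ← Matrix.mul_assoc, ← hB]
    simp only [Matrix.mul_assoc]
  rw [h2]
  exact (h1.mul_mul_conjTranspose_same B).trace_nonneg

lemma alg_ineq {G : Matrix (Fin n) (Fin n) ℂ} (hG : G.PosDef) (A : Fin n → Matrix (Fin n) (Fin n) ℂ)
    (ψ : Fin n → ℂ) (hψ : ∀ α, ψ α = ∑ γ, A γ α γ) (hτ : 0 < G.trace) :
    0 ≤ ∑ γ, (G⁻¹ * A γ * G⁻¹ * (A γ).conjTranspose).trace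
      - (∑ i, ∑ j, G⁻¹ i j * ψ j * star (ψ i)) / G.trace := by
  set h := G⁻¹ with hh
  set τ := G.trace with hτd
  set Q := ∑ i, ∑ j, h i j * ψ j * star (ψ i) with hQ
  have hpd : h.PosDef := hG.inv
  have hu : IsUnit G.det := (Matrix.isUnit_iff_isUnit_det _).mp hG.isUnit
  have hstar : star τ = τ := by
    rw [hτd, ← Matrix.trace_conjTranspose, hG.isHermitian.eq]
  have hτ0 : τ ≠ 0 := hτ.ne'
  let E : Fin n → Matrix (Fin n) (Fin n) ℂ := fun γ => Matrix.vecMulVec ψ (Pi.single γ 1)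
  have hherm : ∀ i j, star (h j i) = h i j := fun i j => hpd.isHermitian.apply i j
  have hE : ∀ γ i k, E γ i k = if k = γ then ψ i else 0 := by
    intro γ i k
    simp [E, Matrix.vecMulVec_apply, Pi.single_apply]
  have hEs : ∀ γ i k, star (E γ i k) = if k = γ then star (ψ i) else 0 := by
    intro γ i k
    rw [hE]
    split_ifs <;> simp
  have t1 : ∑ γ, (h * A γ * (E γ).conjTranspose).trace = Q := by
    simp only [Matrix.trace, Matrix.diag, Matrix.mul_apply, Matrix.conjTranspose_apply, hEs, hQ]
    rw [Finset.sum_comm]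
    refine Finset.sum_congr rfl fun i _ => ?_
    generalize star (ψ i) = s
    simp only [hψ, mul_ite, mul_zero, Finset.sum_ite_eq', Finset.mem_univ, if_true,
      Finset.mul_sum, Finset.sum_mul]
    rw [Finset.sum_comm]
  have t2 : ∑ γ, (h * E γ * (A γ).conjTranspose).trace = Q := by
    simp only [Matrix.trace, Matrix.diag, Matrix.mul_apply, Matrix.conjTranspose_apply, hE, hQ]
    rw [Finset.sum_comm]
    refine Finset.sum_congr rfl fun i _ => ?_
    rw [hψ i]
    simp only [mul_ite, mul_zero,
      Finset.mul_sum, Finset.sum_mul, star_sum, ite_mul, zero_mul]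
    conv_rhs => rw [Finset.sum_comm]
    refine Finset.sum_congr rfl fun j _ => ?_
    rw [Finset.sum_comm]
    simp
  have t3 : ∑ γ, (h * E γ * G * (E γ).conjTranspose).trace = Q * τ := by
    simp only [Matrix.trace, Matrix.diag, Matrix.mul_apply, Matrix.conjTranspose_apply, hEs,
      hQ, hτd]
    simp only [hE]
    rw [Finset.sum_comm, Finset.sum_mul]
    refine Finset.sum_congr rfl fun i _ => ?_
    generalize star (ψ i) = s
    rw [Finset.mul_sum]
    refine Finset.sum_congr rfl fun γ _ => ?_
    simp only [mul_ite, mul_zero, Finset.sum_ite_eq', Finset.mem_univ, if_true,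
      Finset.sum_mul, ite_mul, zero_mul]
    rw [Finset.sum_comm]
    simp only [Finset.sum_ite_eq', Finset.mem_univ, if_true]
    refine Finset.sum_congr rfl fun y _ => ?_
    ring
  have main : 0 ≤ ∑ γ, (h * (A γ - τ⁻¹ • (E γ * G)) * h *
      (A γ - τ⁻¹ • (E γ * G)).conjTranspose).trace :=
    Finset.sum_nonneg fun γ _ => trace_sandwich_nonneg hpd.posSemidef _
  have ex : ∀ γ, (h * (A γ - τ⁻¹ • (E γ * G)) * h *
      (A γ - τ⁻¹ • (E γ * G)).conjTranspose).trace =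
      (h * A γ * h * (A γ).conjTranspose).trace
      - τ⁻¹ * (h * A γ * (E γ).conjTranspose).trace
      - τ⁻¹ * (h * E γ * (A γ).conjTranspose).trace
      + τ⁻¹ * τ⁻¹ * (h * E γ * G * (E γ).conjTranspose).trace := by
    intro γ
    have a1 : G * h = 1 := Matrix.mul_nonsing_inv _ hu
    have a2 : h * G = 1 := Matrix.nonsing_inv_mul _ hu
    have a3 : ∀ X : Matrix (Fin n) (Fin n) ℂ, G * (h * X) = X := fun X => by
      rw [← Matrix.mul_assoc, a1, Matrix.one_mul]
    have a4 : ∀ X : Matrix (Fin n) (Fin n) ℂ, h * (G * X) = X := fun X => by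
      rw [← Matrix.mul_assoc, a2, Matrix.one_mul]
    rw [Matrix.conjTranspose_sub, Matrix.conjTranspose_smul, Matrix.conjTranspose_mul,
      hG.isHermitian.eq, star_inv₀, hstar]
    simp only [Matrix.mul_sub, Matrix.sub_mul, Matrix.mul_smul, Matrix.smul_mul, Matrix.trace_sub,
      Matrix.trace_smul, Matrix.mul_assoc, a3, a4, smul_eq_mul]
    ring
  simp only [ex] at main
  rw [Finset.sum_add_distrib, Finset.sum_sub_distrib, Finset.sum_sub_distrib, ← Finset.mul_sum,
    ← Finset.mul_sum, ← Finset.mul_sum, t1, t2, t3] at main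
  convert main using 1
  field_simp
  ring

/-- The operator `∂/∂z_α`. -/
abbrev DD (α : Fin n) : (Cn n → ℂ) → Cn n → ℂ := XX (-I) (cvec n α 1) (cvec n α I)

/-- The operator `∂/∂z̄_α`. -/
abbrev DB (α : Fin n) : (Cn n → ℂ) → Cn n → ℂ := XX I (cvec n α 1) (cvec n α I)

lemma cHess_eq_s6 (u : Cn n → ℝ) (z : Cn n) (α β : Fin n) :
    cHess u z α β = DD α (DB β fun w => (u w : ℂ)) z := by
  have : (wderBarW univ β fun w => (u w : ℂ)) = (DB β fun w => (u w : ℂ)) := by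
    funext w
    simp [wderBarW, XX]
  simp only [cHess, cHessW, Matrix.of_apply, this, wderW, fderivWithin_univ, DD]
  rw [XX]
  ring

lemma lap_eq {v : Cn n → ℝ} {z : Cn n} (hv : ContDiffAt ℝ (⊤ : ℕ∞) v z) :
    (lap v z : ℂ) = 4 * ∑ α, DD α (DB α fun w => (v w : ℂ)) z := by
  have hc : ContDiffAt ℝ (⊤ : ℕ∞) (fun w => (v w : ℂ)) z :=
    Complex.ofRealCLM.contDiff.contDiffAt.comp z hv
  have hs : IsSymmSndFDerivAt ℝ (fun w => (v w : ℂ)) z :=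
    hc.isSymmSndFDerivAt (by simp; norm_cast)
  have key : ∀ p : Cn n, ((fderiv ℝ (fun y => fderiv ℝ v y p) z p : ℝ) : ℂ) =
      fderiv ℝ (fderiv ℝ (fun w => (v w : ℂ))) z p p := by
    intro p
    have h1 : DifferentiableAt ℝ (fun y => fderiv ℝ v y p) z := by
      have h : DifferentiableAt ℝ (fderiv ℝ v) z :=
        (hv.fderiv_right (m := 1) (by norm_cast)).differentiableAt (by simp)
      exact h.clm_apply (differentiableAt_const p)
    rw [← fderiv_ofReal h1]
    have h2 : (fun y => ((fderiv ℝ v y p : ℝ) : ℂ)) =ᶠ[𝓝 z]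
        fun y => fderiv ℝ (fun w => (v w : ℂ)) y p := by
      have h3 : ∀ᶠ y in 𝓝 z, ContDiffAt ℝ 1 v y :=
        (hv.of_le (by norm_cast)).eventually (by simp)
      filter_upwards [h3] with y hy
      rw [fderiv_ofReal (hy.differentiableAt (by simp))]
    rw [h2.fderiv_eq, (snd_apply hc p).fderiv]
    rfl
  simp only [lap, lapW, fderivWithin_univ]
  push_cast
  rw [Finset.mul_sum]
  refine Finset.sum_congr rfl fun α _ => ?_
  rw [key, key, show DD α (DB α fun w => (v w : ℂ)) z = _ from
    XX_XX hc (-I) I (cvec n α 1) (cvec n α I) (cvec n α 1) (cvec n α I), hs (cvec n α 1) (cvec n α I)]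
  linear_combination ((fderiv ℝ (fderiv ℝ (fun w => (v w : ℂ))) z (cvec n α I) (cvec n α I))) * I_sq

lemma XX_comm4 {U : Set (Cn n)} (hU : IsOpen U) {f : Cn n → ℂ} (hf : Sm U f)
    (c₁ c₂ c₃ c₄ : ℂ) (p₁ p₂ p₃ p₄ q₁ q₂ q₃ q₄ : Cn n) {z : Cn n} (hz : z ∈ U) :
    XX c₁ p₁ q₁ (XX c₂ p₂ q₂ (XX c₃ p₃ q₃ (XX c₄ p₄ q₄ f))) z =
      XX c₃ p₃ q₃ (XX c₄ p₄ q₄ (XX c₁ p₁ q₁ (XX c₂ p₂ q₂ f))) z := by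
  have s4 := hf.XX hU c₄ p₄ q₄
  have s2 := hf.XX hU c₂ p₂ q₂
  have s42 := s2.XX hU c₄ p₄ q₄
  rw [XX_congr hU (fun w hw => XX_comm (s4.at hU hw) c₂ c₃ p₂ q₂ p₃ q₃) c₁ p₁ q₁ hz,
    XX_congr hU (fun w hw => XX_congr hU (fun y hy => XX_comm (hf.at hU hy) c₂ c₄ p₂ q₂ p₄ q₄)
      c₃ p₃ q₃ hw) c₁ p₁ q₁ hz,
    XX_comm (s42.at hU hz),
    XX_congr hU (fun w hw => XX_comm (s2.at hU hw) c₁ c₄ p₁ q₁ p₄ q₄) c₃ p₃ q₃ hz]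

lemma Sm.sum {U : Set (Cn n)} {ι : Type*} {s : Finset ι} {f : ι → Cn n → ℂ}
    (hf : ∀ i, Sm U (f i)) : Sm U (fun w => ∑ i ∈ s, f i w) :=
  ContDiffOn.sum fun i _ => hf i

lemma hess_log_trace {U : Set (Cn n)} (hU : IsOpen U) {T : Cn n → ℝ} {τ : Cn n → ℂ}
    (hτ : Sm U τ) (hT : ∀ w ∈ U, (T w : ℂ) = 4 * τ w) (hpos : ∀ w ∈ U, 0 < T w)
    (α β : Fin n) {z : Cn n} (hz : z ∈ U) :
    cHess (fun w => Real.log (T w)) z α β =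
      (τ z)⁻¹ * DD α (DB β τ) z - DD α τ z * DB β τ z / (τ z) ^ 2 := by
  have hne : ∀ w ∈ U, τ w ≠ 0 := by
    intro w hw h
    have := hT w hw
    rw [h, mul_zero] at this
    exact (hpos w hw).ne' (by exact_mod_cast this)
  have hTd : ∀ w ∈ U, DifferentiableAt ℝ T w := by
    intro w hw
    have h1 : DifferentiableAt ℝ (fun y => (4 * τ y).re) w :=
      Complex.reCLM.differentiableAt.comp w ((hτ.diff hU hw).const_mul 4)
    refine h1.congr_of_eventuallyEq (Filter.eventuallyEq_of_mem (hU.mem_nhds hw) fun y hy => ?_)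
    simp only [← hT y hy, Complex.ofReal_re]
  rw [cHess_eq_s6]
  have h1 : ∀ w ∈ U, DB β (fun w => ((Real.log (T w) : ℝ) : ℂ)) w = (τ w)⁻¹ * DB β τ w := by
    intro w hw
    rw [DB, XX_log (hTd w hw) (hpos w hw).ne', XX_congr hU hT _ _ _ hw,
      XX_mul (differentiableAt_const _) (hτ.diff hU hw), XX_const, hT w hw]
    have := hne w hw
    field_simp
    ring
  rw [DD, XX_congr hU h1 _ _ _ hz,
    XX_mul (f := fun w => (τ w)⁻¹) (g := DB β τ) ((hτ.diff hU hz).inv (hne z hz)) ((hτ.XX hU _ _ _).diff hU hz),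
    XX_inv (hτ.diff hU hz) (hne z hz)]
  ring

lemma ddbar_log_det {U : Set (Cn n)} (hU : IsOpen U) {g : Cn n → Matrix (Fin n) (Fin n) ℂ}
    (hg : ∀ i j, Sm U (fun w => g w i j)) (hpd : ∀ w ∈ U, (g w).PosDef) (γ : Fin n)
    {z : Cn n} (hz : z ∈ U) :
    DD γ (DB γ fun w => ((Real.log ((g w).det.re) : ℝ) : ℂ)) z =
      ((g z)⁻¹ * Matrix.of fun i j => DD γ (DB γ fun w => g w i j) z).trace -
      ((g z)⁻¹ * (Matrix.of fun i j => DD γ (fun w => g w i j) z) * (g z)⁻¹ *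
        (Matrix.of fun i j => DD γ (fun w => g w i j) z).conjTranspose).trace := by
  have hdpos : ∀ w ∈ U, 0 < (g w).det := fun w hw => (hpd w hw).det_pos
  have hne : ∀ w ∈ U, (g w).det ≠ 0 := fun w hw => (hdpos w hw).ne'
  have hre : ∀ w ∈ U, (((g w).det.re : ℝ) : ℂ) = (g w).det := by
    intro w hw
    have := (Complex.lt_def.mp (hdpos w hw)).2
    apply Complex.ext
    · simp
    · simpa using this
  have hrepos : ∀ w ∈ U, 0 < (g w).det.re := fun w hw => (Complex.lt_def.mp (hdpos w hw)).1
  have hdet : Sm U (fun w => (g w).det) := by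
    unfold Sm at *
    simp only [Matrix.det_apply']
    refine ContDiffOn.sum fun σ _ => contDiffOn_const.mul ?_
    exact contDiffOn_prod fun i _ => hg _ _
  have hi := fun i j => Sm.inv_entry hg hne i j
  have h1 : ∀ w ∈ U, DB γ (fun w => ((Real.log ((g w).det.re) : ℝ) : ℂ)) w =
      ∑ i, ∑ k, (g w)⁻¹ i k * DB γ (fun w => g w k i) w := by
    intro w hw
    have hd : DifferentiableAt ℝ (fun y => (g y).det.re) w :=
      Complex.reCLM.differentiableAt.comp w (hdet.diff hU hw)
    rw [DB, XX_log hd (hrepos w hw).ne', XX_congr hU hre _ _ _ hw,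
      XX_det (fun i j => (hg i j).diff hU hw) (hne w hw).isUnit, hre w hw,
      inv_mul_cancel_left₀ (hne w hw)]
    simp [Matrix.trace, Matrix.mul_apply]
  have hB : ∀ i j, DB γ (fun w => g w i j) z = star (DD γ (fun w => g w j i) z) := by
    intro i j
    have := XX_conj ((hg j i).diff hU hz) (-I) (cvec n γ 1) (cvec n γ I)
    rw [← this, DB, show star (-I) = I by simp]
    exact XX_congr hU (fun w hw => ((hpd w hw).isHermitian.apply i j).symm) _ _ _ hz
  have hs : ∀ i k, Sm U (fun w => (g w)⁻¹ i k * DB γ (fun w => g w k i) w) := fun i k =>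
    ContDiffOn.mul (hi i k) ((hg k i).XX hU _ _ _)
  have hinv := XX_minv hU hg hne (-I) (cvec n γ 1) (cvec n γ I) hz
  have hinv' : ∀ i k, DD γ (fun w => (g w)⁻¹ i k) z = -((g z)⁻¹ *
      (Matrix.of fun i j => DD γ (fun w => g w i j) z) * (g z)⁻¹) i k := fun i k =>
    congrFun (congrFun hinv i) k
  rw [DD, XX_congr hU h1 _ _ _ hz,
    XX_sum (f := fun i w => ∑ k, (g w)⁻¹ i k * DB γ (fun w => g w k i) w) _
      (fun i => (Sm.sum (hs i)).diff hU hz)]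
  set M := (g z)⁻¹ * (Matrix.of fun i j => DD γ (fun w => g w i j) z) * (g z)⁻¹ with hM
  rw [Matrix.trace, Matrix.trace, ← Finset.sum_sub_distrib]
  refine Finset.sum_congr rfl fun i _ => ?_
  rw [XX_sum (f := fun k w => (g w)⁻¹ i k * DB γ (fun w => g w k i) w) _
      (fun k => (hs i k).diff hU hz)]
  rw [Matrix.diag, Matrix.diag, Matrix.mul_apply, Matrix.mul_apply, ← Finset.sum_sub_distrib]
  refine Finset.sum_congr rfl fun k _ => ?_
  rw [XX_mul ((hi i k).diff hU hz) (((hg k i).XX hU _ _ _).diff hU hz)]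
  have e1 := hinv' i k
  have e2 := hB k i
  simp only [Matrix.of_apply, Matrix.conjTranspose_apply, DD, DB] at e1 e2 ⊢
  rw [e1, e2]
  ring

/-- **The Laplacian inequality for `Σ u^{αβ̄} (log Δu)_{αβ̄}`** (remark after Theorem 2.5):
if `u` is a smooth strictly plurisubharmonic function on an open set `U ⊆ ℂⁿ` with `Δu > 0`,
then `Σ u^{αβ̄} (log Δu)_{αβ̄} ≥ (Δ log det(u_{αβ̄}))/(Δu)` on `U`, where `(u^{αβ̄})` is the
transpose of the inverse of the complex Hessian `(u_{αβ̄})`. -/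
theorem stmt_6 (n : ℕ) (U : Set (Cn n)) (hU : IsOpen U) (u : Cn n → ℝ)
    (hu : ContDiffOn ℝ (⊤ : ℕ∞) u U)
    (hpsh : ∀ z ∈ U, (cHess u z).PosDef)
    (hlap : ∀ z ∈ U, 0 < lap u z) :
    ∀ z ∈ U,
      lap (fun w => Real.log ((cHess u w).det.re)) z / lap u z ≤
        (∑ α, ∑ β, ((cHess u z)⁻¹).transpose α β
          * cHess (fun w => Real.log (lap u w)) z α β).re := by
  intro z hz
  have huc : Sm U (fun w => (u w : ℂ)) := Complex.ofRealCLM.contDiff.comp_contDiffOn hu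
  have hg : ∀ i j, Sm U (fun w => cHess u w i j) := by
    intro i j
    simp only [cHess_eq_s6]
    exact (huc.XX hU _ _ _).XX hU _ _ _
  set τ : Cn n → ℂ := fun w => ∑ γ, cHess u w γ γ with hτd
  have hτ : Sm U τ := Sm.sum fun γ => hg γ γ
  have hT : ∀ w ∈ U, (lap u w : ℂ) = 4 * τ w := by
    intro w hw
    rw [lap_eq (hu.contDiffAt (hU.mem_nhds hw))]
    simp only [hτd, cHess_eq_s6]
  have hτpos : 0 < τ z := by
    have h1 : τ z = ((lap u z / 4 : ℝ) : ℂ) := by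
      push_cast
      rw [hT z hz]
      ring
    rw [h1]
    have := hlap z hz
    exact_mod_cast (by positivity : (0:ℝ) < lap u z / 4)
  set G := cHess u z with hG
  have hGτ : G.trace = τ z := rfl
  let A : Fin n → Matrix (Fin n) (Fin n) ℂ := fun γ =>
    Matrix.of fun i j => DD γ (fun w => cHess u w i j) z
  let F : Fin n → Matrix (Fin n) (Fin n) ℂ := fun γ =>
    Matrix.of fun i j => DD γ (DB γ fun w => cHess u w i j) z
  let ψ : Fin n → ℂ := fun α => DD α τ z
  have hψ : ∀ α, ψ α = ∑ γ, A γ α γ := by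
    intro α
    simp only [ψ, A, Matrix.of_apply, hτd]
    rw [DD, XX_sum (f := fun γ w => cHess u w γ γ) _ (fun γ => (hg γ γ).diff hU hz)]
    refine Finset.sum_congr rfl fun γ _ => ?_
    simp only [cHess_eq_s6]
    exact XX_comm ((huc.XX hU _ _ _).at hU hz) _ _ _ _ _ _
  have hψb : ∀ β, DB β τ z = star (ψ β) := by
    intro β
    have := XX_conj (hτ.diff hU hz) (-I) (cvec n β 1) (cvec n β I)
    simp only [ψ]
    rw [← this, DB, show star (-I) = I by simp]
    refine XX_congr hU (fun w hw => ?_) _ _ _ hz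
    simp only [hτd, star_sum]
    exact Finset.sum_congr rfl fun γ _ => ((hpsh w hw).isHermitian.apply γ γ).symm
  have hττ : ∀ α β, DD α (DB β τ) z = ∑ γ, F γ α β := by
    intro α β
    have h1 : ∀ w ∈ U, DB β τ w = ∑ γ, DB β (fun y => cHess u y γ γ) w := fun w hw =>
      XX_sum (f := fun γ w => cHess u w γ γ) _ (fun γ => (hg γ γ).diff hU hw) _ _ _
    rw [DD, XX_congr hU h1 _ _ _ hz, XX_sum (f := fun γ => DB β (fun y => cHess u y γ γ)) _
      (fun γ => ((hg γ γ).XX hU _ _ _).diff hU hz)]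
    refine Finset.sum_congr rfl fun γ _ => ?_
    simp only [F, Matrix.of_apply, cHess_eq_s6]
    exact XX_comm4 hU huc _ _ _ _ _ _ _ _ _ _ _ _ hz
  have hR : (∑ α, ∑ β, (G⁻¹).transpose α β * cHess (fun w => Real.log (lap u w)) z α β) =
      (∑ γ, (G⁻¹ * F γ).trace) / τ z
        - (∑ i, ∑ j, G⁻¹ i j * ψ j * star (ψ i)) / (τ z) ^ 2 := by
    have h1 : ∑ γ, (G⁻¹ * F γ).trace = ∑ β, ∑ α, G⁻¹ β α * ∑ γ, F γ α β := by
      simp only [Matrix.trace, Matrix.diag, Matrix.mul_apply, Finset.mul_sum]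
      rw [Finset.sum_comm]
      refine Finset.sum_congr rfl fun β _ => ?_
      rw [Finset.sum_comm]
    rw [h1, Finset.sum_comm, Finset.sum_div, Finset.sum_div, ← Finset.sum_sub_distrib]
    refine Finset.sum_congr rfl fun β _ => ?_
    rw [Finset.sum_div, Finset.sum_div, ← Finset.sum_sub_distrib]
    refine Finset.sum_congr rfl fun α _ => ?_
    rw [hess_log_trace hU hτ hT hlap α β hz, hττ, hψb, Matrix.transpose_apply]
    simp only [ψ]
    ring
  have hdet : Sm U (fun w => (cHess u w).det) := by
    unfold Sm at *
    simp only [Matrix.det_apply']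
    refine ContDiffOn.sum fun σ _ => contDiffOn_const.mul ?_
    exact contDiffOn_prod fun i _ => hg _ _
  have hlogsm : ContDiffAt ℝ (⊤ : ℕ∞) (fun w => Real.log ((cHess u w).det.re)) z := by
    have h1 : ContDiffAt ℝ (⊤ : ℕ∞) (fun w => (cHess u w).det.re) z :=
      Complex.reCLM.contDiff.contDiffAt.comp z (hdet.at hU hz)
    exact h1.log (Complex.lt_def.mp (hpsh z hz).det_pos).1.ne'
  have hL : ((lap (fun w => Real.log ((cHess u w).det.re)) z / lap u z : ℝ) : ℂ) =
      (∑ γ, (G⁻¹ * F γ).trace - ∑ γ, (G⁻¹ * A γ * G⁻¹ * (A γ).conjTranspose).trace) / τ z := by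
    push_cast
    rw [lap_eq hlogsm, hT z hz, mul_div_mul_left _ _ (by norm_num : (4:ℂ) ≠ 0),
      ← Finset.sum_sub_distrib]
    congr 1
    exact Finset.sum_congr rfl fun γ _ => ddbar_log_det hU hg hpsh γ hz
  have key := alg_ineq (hpsh z hz) A ψ hψ hτpos
  rw [hR, ← Complex.ofReal_re (lap (fun w => Real.log ((cHess u w).det.re)) z / lap u z), hL,
    ← sub_nonneg, ← Complex.sub_re]
  have fin : 0 ≤ (∑ γ, (G⁻¹ * A γ * G⁻¹ * (A γ).conjTranspose).trace
      - (∑ i, ∑ j, G⁻¹ i j * ψ j * star (ψ i)) / τ z) * (τ z)⁻¹ :=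
    mul_nonneg key (inv_nonneg.mpr hτpos.le)
  have fin2 := (Complex.le_def.mp fin).1
  rw [Complex.zero_re] at fin2
  refine fin2.trans (le_of_eq (congrArg Complex.re ?_))
  ring
end
end

section
/- Under the a priori hypotheses, for every m > 2/T there exists C₃ > 0 depending only on Ω, C_φ and the subsolution constant M_m (hence only on Ω, T, C_u, C_φ, C_f, m) such that |∇u| ≤ C₃ on ∂Ω×(2/m, T). -/
open Set Metric Complex Topology Filter Bornology
open scoped ComplexOrder

noncomputable section

variable {n : ℕ}

/-- Membership in `C^{2;1}(Ω̄ × [0,T))`: `u(·,t) ∈ C²(Ω̄)` for each `t ∈ [0,T)`,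
`u(z,·) ∈ C¹([0,T))` for each `z ∈ Ω̄`, and `∂u/∂t` together with all second spatial
derivatives are continuous on `Ω̄ × [0,T)`. -/
def C21 (n : ℕ) (Ω : Set (Cn n)) (T : ℝ) (u : Cn n × ℝ → ℝ) : Prop :=
  (∀ t ∈ Ico (0 : ℝ) T, ContDiffOn ℝ 2 (fun z => u (z, t)) (closure Ω)) ∧
  (∀ z ∈ closure Ω, ContDiffOn ℝ 1 (fun s => u (z, s)) (Ico (0 : ℝ) T)) ∧
  ContinuousOn (fun p : Cn n × ℝ => derivWithin (fun s => u (p.1, s)) (Ico (0 : ℝ) T) p.2)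
    (closure Ω ×ˢ Ico (0 : ℝ) T) ∧
  ∀ v w : Cn n, ContinuousOn
    (fun p : Cn n × ℝ =>
      fderivWithin ℝ (fun y => fderivWithin ℝ (fun x => u (x, p.2)) (closure Ω) y v)
        (closure Ω) p.1 w)
    (closure Ω ×ˢ Ico (0 : ℝ) T)

/-- The hypotheses of the a priori estimates theorem: `φ ∈ C^∞(Ω̄×[0,T))`,
`f ∈ C^∞([0,T)×Ω̄×ℝ)`, `u ∈ C^∞(Ω×(0,T)) ∩ C^{2;1}(Ω̄×[0,T))` is strictly plurisubharmonic
in `z` and solves `∂u/∂t = log det(u_{αβ̄}) + f(t,z,u)` on `Ω×(0,T)` with `u = φ` on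
`∂Ω×[0,T)`, `sup_Ω |u(·,0)| ≤ Cu`, `f` nonincreasing in the last variable,
`‖f‖_{C²((0,T)×Ω×ℝ)} ≤ Cf` and `‖φ‖_{C⁴(Ω×(0,T))} ≤ Cφv` (parabolic norm). -/
def AprioriHyps (n : ℕ) (Ω : Set (Cn n)) (T Cu Cφv Cf : ℝ)
    (u φ : Cn n × ℝ → ℝ) (f : ℝ × Cn n × ℝ → ℝ) : Prop :=
  ContDiffOn ℝ (⊤ : ℕ∞) φ (closure Ω ×ˢ Ico (0 : ℝ) T) ∧
  ContDiffOn ℝ (⊤ : ℕ∞) f (Ico (0 : ℝ) T ×ˢ closure Ω ×ˢ (univ : Set ℝ)) ∧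
  ContDiffOn ℝ (⊤ : ℕ∞) u (Ω ×ˢ Ioo (0 : ℝ) T) ∧
  C21 n Ω T u ∧
  (∀ t ∈ Ioo (0 : ℝ) T, ∀ z ∈ Ω, (cHess (fun w => u (w, t)) z).PosDef) ∧
  (∀ z ∈ Ω, ∀ t ∈ Ioo (0 : ℝ) T,
    deriv (fun s => u (z, s)) t
      = Real.log ((cHess (fun w => u (w, t)) z).det.re) + f (t, z, u (z, t))) ∧
  (∀ z ∈ frontier Ω, ∀ t ∈ Ico (0 : ℝ) T, u (z, t) = φ (z, t)) ∧
  (∀ z ∈ Ω, |u (z, 0)| ≤ Cu) ∧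
  (∀ t ∈ Ioo (0 : ℝ) T, ∀ z ∈ Ω, ∀ r : ℝ, deriv (fun y => f (t, z, y)) r ≤ 0) ∧
  (∀ k : ℕ, k ≤ 2 → ∀ p ∈ Ioo (0 : ℝ) T ×ˢ Ω ×ˢ (univ : Set ℝ),
    ‖iteratedFDeriv ℝ k f p‖ ≤ Cf) ∧
  (∀ j l : ℕ, j + 2 * l ≤ 4 → ∀ z ∈ Ω, ∀ t ∈ Ioo (0 : ℝ) T,
    ‖iteratedFDeriv ℝ j (fun w => iteratedDeriv l (fun s => φ (w, s)) t) z‖ ≤ Cφv)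

def levi (g : Cn n → ℝ) (z ξ : Cn n) : ℝ :=
  fderiv ℝ (fderiv ℝ g) z ξ ξ + fderiv ℝ (fderiv ℝ g) z (Complex.I • ξ) (Complex.I • ξ)

lemma fderiv_ofReal_comp {g : Cn n → ℝ} {w : Cn n} (hg : DifferentiableAt ℝ g w) (v : Cn n) :
    fderiv ℝ (fun y => (g y : ℂ)) w v = (fderiv ℝ g w v : ℂ) := by
  have h := (Complex.ofRealCLM.hasFDerivAt (x := g w)).comp w hg.hasFDerivAt
  have h2 : HasFDerivAt (fun y => (g y : ℂ)) (Complex.ofRealCLM.comp (fderiv ℝ g w)) w := h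
  rw [h2.fderiv]; simp

lemma hasFDerivAt_apply_gen {E : Type*} [NormedAddCommGroup E] [NormedSpace ℝ E] {g : E → ℝ} {z : E}
    (hD : HasFDerivAt (fderiv ℝ g) (fderiv ℝ (fderiv ℝ g) z) z) (e : E) :
    HasFDerivAt (fun w => (fderiv ℝ g w e : ℂ))
      (Complex.ofRealCLM.comp ((fderiv ℝ (fderiv ℝ g) z).flip e)) z := by
  have h1 : HasFDerivAt (fun w => fderiv ℝ g w e) ((fderiv ℝ (fderiv ℝ g) z).flip e) z := by
    have := hD.clm_apply (hasFDerivAt_const e z)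
    simpa using this
  exact (Complex.ofRealCLM.hasFDerivAt).comp z h1

lemma cHess_entry {g : Cn n → ℝ} {z : Cn n} (hg : ContDiffAt ℝ 2 g z) (α β : Fin n) :
    cHess g z α β =
      (((fderiv ℝ (fderiv ℝ g) z (cvec n α 1) (cvec n β 1)
        + fderiv ℝ (fderiv ℝ g) z (cvec n α I) (cvec n β I) : ℝ) : ℂ)
      + I * ((fderiv ℝ (fderiv ℝ g) z (cvec n α 1) (cvec n β I)
        - fderiv ℝ (fderiv ℝ g) z (cvec n α I) (cvec n β 1) : ℝ) : ℂ)) / 4 := by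
  have hev : (wderBarW univ β fun w => (g w : ℂ)) =ᶠ[𝓝 z]
      fun w => ((fderiv ℝ g w (cvec n β 1) : ℂ) + I * (fderiv ℝ g w (cvec n β I) : ℂ)) / 2 := by
    have h1 : ∀ᶠ w in 𝓝 z, ContDiffAt ℝ 2 g w := hg.eventually (by simp)
    filter_upwards [h1] with w hw
    have hd : DifferentiableAt ℝ g w := hw.differentiableAt (by simp)
    simp only [wderBarW, fderivWithin_univ, fderiv_ofReal_comp hd]
  have hD : HasFDerivAt (fderiv ℝ g) (fderiv ℝ (fderiv ℝ g) z) z :=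
    ((hg.fderiv_right (m := 1) (by norm_num)).differentiableAt (by simp)).hasFDerivAt
  have hev2 : ∀ e : Cn n, HasFDerivAt (fun w => (fderiv ℝ g w e : ℂ))
      (Complex.ofRealCLM.comp ((fderiv ℝ (fderiv ℝ g) z).flip e)) z := by
    intro e
    exact hasFDerivAt_apply_gen hD e
  have hF : HasFDerivAt (fun w => (2:ℂ)⁻¹ * ((fderiv ℝ g w (cvec n β 1) : ℂ) +
      I * (fderiv ℝ g w (cvec n β I) : ℂ))) _ z :=
    (((hev2 (cvec n β 1)).add ((hev2 (cvec n β I)).const_mul I))).const_mul (2:ℂ)⁻¹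
  have hev' : (wderBarW univ β fun w => (g w : ℂ)) =ᶠ[𝓝 z]
      fun w => (2:ℂ)⁻¹ * ((fderiv ℝ g w (cvec n β 1) : ℂ) +
        I * (fderiv ℝ g w (cvec n β I) : ℂ)) := by
    filter_upwards [hev] with w hw
    rw [hw]; ring
  simp only [cHess, cHessW, Matrix.of_apply, wderW, fderivWithin_univ]
  rw [hev'.fderiv_eq, hF.fderiv]
  simp
  ring_nf
  simp
  ring

lemma vec_expand (x : Fin n → ℂ) :
    (WithLp.toLp 2 (star x) : Cn n) =
      ∑ α, ((x α).re • cvec n α 1 - (x α).im • cvec n α I) := by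
  ext i
  simp [cvec, Finset.sum_apply, Pi.single_apply]
  apply Complex.ext <;> simp [Pi.single_apply, Finset.sum_ite_eq, apply_ite]

lemma vec_expandI (x : Fin n → ℂ) :
    (I • WithLp.toLp 2 (star x) : Cn n) =
      ∑ α, ((x α).re • cvec n α I + (x α).im • cvec n α 1) := by
  rw [vec_expand, Finset.smul_sum]
  refine Finset.sum_congr rfl fun α _ => ?_
  ext i
  by_cases h : i = α
  · subst h
    simp [cvec]
    linear_combination (-(x i).im : ℂ) * I_mul_I
  · simp [cvec, h]

lemma re_cHess {g : Cn n → ℝ} {z : Cn n} (hg : ContDiffAt ℝ 2 g z) (x : Fin n → ℂ) :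
    (star x ⬝ᵥ (cHess g z).mulVec x).re = levi g z (WithLp.toLp 2 (star x)) / 4 := by
  rw [levi, vec_expandI, vec_expand]
  simp only [dotProduct, Matrix.mulVec, cHess_entry hg, map_sum, Finset.mul_sum,
    Complex.re_sum, _root_.sum_apply, ← Finset.sum_add_distrib, Finset.sum_div]
  rw [Finset.sum_comm]
  refine Finset.sum_congr rfl fun α _ => Finset.sum_congr rfl fun β _ => ?_
  simp
  ring

lemma second_deriv_nonpos_s8 {g : ℝ → ℝ} (hg : ContDiffAt ℝ 2 g 0) (hmax : IsLocalMax g 0) :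
    deriv (deriv g) 0 ≤ 0 := by
  by_contra! h
  have h0 := hmax.deriv_eq_zero
  have hmin := isLocalMin_of_deriv_deriv_pos h h0 hg.continuousAt
  have hc : g =ᶠ[𝓝 0] fun _ => g 0 := by
    filter_upwards [hmin, hmax] with x h1 h2
    exact le_antisymm h2 h1
  have := hc.deriv.deriv_eq
  simp at this
  linarith

lemma hess_nonpos {E : Type*} [NormedAddCommGroup E] [NormedSpace ℝ E] {g : E → ℝ} {z : E} (hg : ContDiffAt ℝ 2 g z) (hmax : IsLocalMax g z)
    (ξ : E) : fderiv ℝ (fderiv ℝ g) z ξ ξ ≤ 0 := by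
  have hl : ContDiff ℝ 2 (fun s : ℝ => z + s • ξ) := by fun_prop
  have hz : z + (0:ℝ) • ξ = z := by simp
  have hline : Tendsto (fun s : ℝ => z + s • ξ) (𝓝 0) (𝓝 z) := by
    have := hl.continuous.tendsto 0
    simpa using this
  have hD1 : ∀ s : ℝ, HasDerivAt (fun s : ℝ => z + s • ξ) ξ s := by
    intro s
    simpa using ((hasDerivAt_id s).smul_const ξ).const_add z
  have hc : ContDiffAt ℝ 2 (fun s : ℝ => g (z + s • ξ)) 0 :=
    ContDiffAt.comp (0:ℝ) (by rw [hz]; exact hg) hl.contDiffAt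
  have hm : IsLocalMax (fun s : ℝ => g (z + s • ξ)) 0 := by
    have := hline.eventually hmax
    filter_upwards [this] with s hs
    simpa using hs
  have h := second_deriv_nonpos_s8 hc hm
  have hev : deriv (fun s : ℝ => g (z + s • ξ)) =ᶠ[𝓝 0] fun s => fderiv ℝ g (z + s • ξ) ξ := by
    have h1 : ∀ᶠ w in 𝓝 z, ContDiffAt ℝ 2 g w := hg.eventually (by simp)
    filter_upwards [hline.eventually h1] with s hs
    have hd : DifferentiableAt ℝ g (z + s • ξ) := hs.differentiableAt (by simp)
    exact (hd.hasFDerivAt.comp_hasDerivAt s (hD1 s)).deriv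
  rw [hev.deriv_eq] at h
  have hD : HasFDerivAt (fderiv ℝ g) (fderiv ℝ (fderiv ℝ g) z) (z + (0:ℝ) • ξ) := by
    rw [hz]
    exact ((hg.fderiv_right (m := 1) (by norm_num)).differentiableAt (by simp)).hasFDerivAt
  have h2 : HasDerivAt (fun s : ℝ => fderiv ℝ g (z + s • ξ)) (fderiv ℝ (fderiv ℝ g) z ξ) 0 :=
    hD.comp_hasDerivAt (0:ℝ) (hD1 0)
  have h4 : HasDerivAt (fun s : ℝ => fderiv ℝ g (z + s • ξ) ξ)
      (fderiv ℝ (fderiv ℝ g) z ξ ξ) 0 := by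
    simpa using h2.clm_apply (hasDerivAt_const (0:ℝ) ξ)
  rw [h4.deriv] at h
  exact h

lemma levi_nonpos {g : Cn n → ℝ} {z : Cn n} (hg : ContDiffAt ℝ 2 g z) (hmax : IsLocalMax g z)
    (ξ : Cn n) : levi g z ξ ≤ 0 :=
  add_nonpos (hess_nonpos hg hmax _) (hess_nonpos hg hmax _)

lemma det_lower {B : Matrix (Fin n) (Fin n) ℂ} (hB : B.IsHermitian) {L : ℝ} (hL : 0 ≤ L)
    (h : ∀ x : Cn n, L * ‖x‖ ^ 2 ≤ (star (x : Fin n → ℂ) ⬝ᵥ B.mulVec (x : Fin n → ℂ)).re) :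
    L ^ n ≤ B.det.re := by
  have h1 : ∀ i, L ≤ hB.eigenvalues i := by
    intro i
    have := h (hB.eigenvectorBasis i)
    rw [hB.eigenvalues_eq]
    simpa [hB.eigenvectorBasis.orthonormal.1 i] using this
  rw [hB.det_eq_prod_eigenvalues]
  have : (∏ i, (hB.eigenvalues i : ℂ)).re = ∏ i, hB.eigenvalues i := by
    rw [← Complex.ofReal_prod]; exact Complex.ofReal_re _
  have h2 : L ^ n = ∏ _i : Fin n, L := by simp
  erw [this]
  rw [h2]
  exact Finset.prod_le_prod (fun _ _ => hL) (fun i _ => h1 i)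

lemma fderiv2_comb {E : Type*} [NormedAddCommGroup E] [NormedSpace ℝ E] {g h k : E → ℝ} {z : E}
    (hg : ContDiffAt ℝ 2 g z) (hh : ContDiffAt ℝ 2 h z) (hk : ContDiffAt ℝ 2 k z) (a b c d : ℝ) :
    fderiv ℝ (fderiv ℝ (fun w => a * g w + b * h w + c * k w + d)) z
      = a • fderiv ℝ (fderiv ℝ g) z + b • fderiv ℝ (fderiv ℝ h) z
        + c • fderiv ℝ (fderiv ℝ k) z := by
  have key : ∀ {g : E → ℝ}, ContDiffAt ℝ 2 g z →
      HasFDerivAt (fderiv ℝ g) (fderiv ℝ (fderiv ℝ g) z) z := fun hg =>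
    ((hg.fderiv_right (m := 1) (by norm_num)).differentiableAt (by simp)).hasFDerivAt
  have hev : fderiv ℝ (fun w => a * g w + b * h w + c * k w + d) =ᶠ[𝓝 z]
      fun w => a • fderiv ℝ g w + b • fderiv ℝ h w + c • fderiv ℝ k w := by
    filter_upwards [hg.eventually (by simp), hh.eventually (by simp),
      hk.eventually (by simp)] with w h1 h2 h3
    have d1 : HasFDerivAt g (fderiv ℝ g w) w := (h1.differentiableAt (by simp)).hasFDerivAt
    have d2 : HasFDerivAt h (fderiv ℝ h w) w := (h2.differentiableAt (by simp)).hasFDerivAt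
    have d3 : HasFDerivAt k (fderiv ℝ k w) w := (h3.differentiableAt (by simp)).hasFDerivAt
    exact ((((d1.const_mul a).add (d2.const_mul b)).add (d3.const_mul c)).add_const d).fderiv
  rw [hev.fderiv_eq]
  exact ((((key hg).const_smul a).add ((key hh).const_smul b)).add ((key hk).const_smul c)).fderiv

lemma levi_comb {g h k : Cn n → ℝ} {z : Cn n}
    (hg : ContDiffAt ℝ 2 g z) (hh : ContDiffAt ℝ 2 h z) (hk : ContDiffAt ℝ 2 k z) (a b c d : ℝ)
    (ξ : Cn n) :
    levi (fun w => a * g w + b * h w + c * k w + d) z ξ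
      = a * levi g z ξ + b * levi h z ξ + c * levi k z ξ := by
  simp only [levi, fderiv2_comb hg hh hk]
  simp
  ring

lemma abs_levi_le {g : Cn n → ℝ} {z : Cn n} {C : ℝ} (h : ‖iteratedFDeriv ℝ 2 g z‖ ≤ C)
    (ξ : Cn n) : |levi g z ξ| ≤ 2 * C * ‖ξ‖ ^ 2 := by
  have key : ∀ η : Cn n, |fderiv ℝ (fderiv ℝ g) z η η| ≤ C * ‖η‖ ^ 2 := by
    intro η
    have h1 := (iteratedFDeriv ℝ 2 g z).le_opNorm ![η, η]
    rw [iteratedFDeriv_two_apply] at h1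
    simp [Fin.prod_univ_two] at h1
    refine h1.trans ?_
    rw [sq]
    gcongr
  have h1 := key ξ
  have h2 := key (I • ξ)
  have h3 : ‖I • ξ‖ = ‖ξ‖ := by rw [norm_smul]; simp
  rw [h3] at h2
  refine (abs_add_le _ _).trans ?_
  linarith

lemma levi_eq_re {g : Cn n → ℝ} {z : Cn n} (hg : ContDiffAt ℝ 2 g z) (ξ : Cn n) :
    levi g z ξ = 4 * (star (star (ξ : Fin n → ℂ)) ⬝ᵥ
      (cHess g z).mulVec (star (ξ : Fin n → ℂ))).re := by
  rw [re_cHess hg]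
  simp only [star_star]
  ring_nf

lemma levi_pos {g : Cn n → ℝ} {z : Cn n} (hg : ContDiffAt ℝ 2 g z) (hp : (cHess g z).PosDef)
    {ξ : Cn n} (hξ : ξ ≠ 0) : 0 < levi g z ξ := by
  rw [levi_eq_re hg]
  have : star (ξ : Fin n → ℂ) ≠ 0 := by
    rw [Ne, star_eq_zero]
    intro h
    apply hξ
    ext i
    simpa using congrFun h i
  have := hp.re_dotProduct_pos this
  have h2 : 0 < (star (star (ξ : Fin n → ℂ)) ⬝ᵥ
      (cHess g z).mulVec (star (ξ : Fin n → ℂ))).re := this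
  linarith

lemma levi_smul (g : Cn n → ℝ) (z ξ : Cn n) (r : ℝ) : levi g z (r • ξ) = r ^ 2 * levi g z ξ := by
  simp only [levi, smul_comm I r ξ, map_smul, _root_.smul_apply, smul_eq_mul]
  ring

lemma levi_lower {U K : Set (Cn n)} {ρ : Cn n → ℝ} (hU : IsOpen U) (hK : IsCompact K)
    (hKU : K ⊆ U) (hρ : ContDiffOn ℝ 2 ρ U) (hp : ∀ z ∈ U, (cHess ρ z).PosDef) :
    ∃ l : ℝ, 0 < l ∧ ∀ z ∈ K, ∀ ξ : Cn n, l * ‖ξ‖ ^ 2 ≤ levi ρ z ξ := by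
  have h1 : ContDiffOn ℝ 1 (fderiv ℝ ρ) U := hρ.fderiv_of_isOpen hU (by norm_num)
  have h2 : ContinuousOn (fderiv ℝ (fderiv ℝ ρ)) U := h1.continuousOn_fderiv_of_isOpen hU (by simp)
  have h3 : ContinuousOn (fun p : Cn n × Cn n => levi ρ p.1 p.2) (K ×ˢ sphere (0 : Cn n) 1) := by
    have h4 : ContinuousOn (fun p : Cn n × Cn n => fderiv ℝ (fderiv ℝ ρ) p.1)
        (K ×ˢ sphere (0 : Cn n) 1) := h2.comp continuousOn_fst (fun p hp => hKU hp.1)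
    have h5 : ContinuousOn (fun p : Cn n × Cn n => p.2) (K ×ˢ sphere (0 : Cn n) 1) :=
      continuousOn_snd
    have h6 : ContinuousOn (fun p : Cn n × Cn n => I • p.2) (K ×ˢ sphere (0 : Cn n) 1) :=
      h5.const_smul I
    exact ((h4.clm_apply h5).clm_apply h5).add ((h4.clm_apply h6).clm_apply h6)
  have hcomp : IsCompact (K ×ˢ sphere (0 : Cn n) 1) := hK.prod (isCompact_sphere _ _)
  have hunit : ∃ l : ℝ, 0 < l ∧ ∀ z ∈ K, ∀ ξ ∈ sphere (0 : Cn n) 1, l ≤ levi ρ z ξ := by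
    rcases (K ×ˢ sphere (0 : Cn n) 1).eq_empty_or_nonempty with he | hne
    · refine ⟨1, one_pos, fun z hz ξ hξ => ?_⟩
      have : (z, ξ) ∈ K ×ˢ sphere (0 : Cn n) 1 := ⟨hz, hξ⟩
      rw [he] at this
      exact this.elim
    · obtain ⟨p, hpm, hmin⟩ := hcomp.exists_isMinOn hne h3
      refine ⟨levi ρ p.1 p.2, levi_pos (hρ.contDiffAt (hU.mem_nhds (hKU hpm.1)))
        (hp _ (hKU hpm.1)) ?_, fun z hz ξ hξ => ?_⟩
      · intro h0
        have := hpm.2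
        rw [h0] at this
        simp at this
      · exact hmin (show (z, ξ) ∈ K ×ˢ sphere (0 : Cn n) 1 from ⟨hz, hξ⟩)
  obtain ⟨l, hl, hlb⟩ := hunit
  refine ⟨l, hl, fun z hz ξ => ?_⟩
  by_cases h0 : ξ = 0
  · subst h0; simp [levi]
  · have hn : ‖ξ‖ ≠ 0 := norm_ne_zero_iff.2 h0
    have hs : ‖ξ‖⁻¹ • ξ ∈ sphere (0 : Cn n) 1 := by
      rw [mem_sphere_zero_iff_norm, norm_smul, norm_inv, norm_norm, inv_mul_cancel₀ hn]
    have h := hlb z hz _ hs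
    have he : ξ = ‖ξ‖ • (‖ξ‖⁻¹ • ξ) := by rw [smul_smul, mul_inv_cancel₀ hn, one_smul]
    have h7 : levi ρ z ξ = ‖ξ‖ ^ 2 * levi ρ z (‖ξ‖⁻¹ • ξ) := by
      rw [← levi_smul, ← he]
    rw [h7, mul_comm l]
    gcongr

lemma u_cont {Ω : Set (Cn n)} {T : ℝ} {u : Cn n × ℝ → ℝ} (h : C21 n Ω T u) :
    ContinuousOn u (closure Ω ×ˢ Ico (0 : ℝ) T) := by
  obtain ⟨h1, h2, h3, -⟩ := h
  rintro ⟨z0, t0⟩ ⟨hz0, ht0⟩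
  simp only at hz0 ht0
  set F : Cn n × ℝ → ℝ := fun p => derivWithin (fun s => u (p.1, s)) (Ico (0 : ℝ) T) p.2 with hF
  have hc := h3 (z0, t0) ⟨hz0, ht0⟩
  set B := ‖F (z0, t0)‖ + 1 with hB
  have hb : ∀ᶠ p in 𝓝[closure Ω ×ˢ Ico (0 : ℝ) T] (z0, t0), ‖F p‖ < B :=
    hc.norm.eventually_lt_const (by simp [hB, hF])
  obtain ⟨δ, hδ, hball⟩ := Metric.mem_nhdsWithin_iff.1 hb
  have hsp : Tendsto (fun p : Cn n × ℝ => u (p.1, t0)) (𝓝[closure Ω ×ˢ Ico (0 : ℝ) T] (z0, t0))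
      (𝓝 (u (z0, t0))) := by
    have := (h1 t0 ht0).continuousOn z0 hz0
    refine Tendsto.comp (g := fun z => u (z, t0)) this ?_
    exact tendsto_nhdsWithin_iff.2 ⟨(continuous_fst.tendsto _).mono_left nhdsWithin_le_nhds,
      eventually_mem_nhdsWithin.mono fun p hp => hp.1⟩
  have hd : Tendsto (fun p : Cn n × ℝ => u p - u (p.1, t0))
      (𝓝[closure Ω ×ˢ Ico (0 : ℝ) T] (z0, t0)) (𝓝 0) := by
    have hz : Tendsto (fun p : Cn n × ℝ => B * ‖p.2 - t0‖)
        (𝓝[closure Ω ×ˢ Ico (0 : ℝ) T] (z0, t0)) (𝓝 0) := by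
      have : Continuous (fun p : Cn n × ℝ => B * ‖p.2 - t0‖) := by fun_prop
      have := this.tendsto (z0, t0)
      simp only [sub_self, norm_zero, mul_zero] at this
      exact this.mono_left nhdsWithin_le_nhds
    refine squeeze_zero_norm' ?_ hz
    filter_upwards [eventually_mem_nhdsWithin,
      mem_nhdsWithin_of_mem_nhds (Metric.ball_mem_nhds (z0, t0) hδ)] with p hp hpb
    have hpb' : dist p.1 z0 < δ ∧ dist p.2 t0 < δ := by
      rw [Metric.mem_ball, Prod.dist_eq, max_lt_iff] at hpb
      exact hpb
    have hconv : Convex ℝ (Ico (0 : ℝ) T ∩ Metric.ball t0 δ) :=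
      (convex_Ico 0 T).inter (convex_ball t0 δ)
    refine Convex.norm_image_sub_le_of_norm_hasDerivWithin_le (f := fun s => u (p.1, s))
      (f' := fun s => F (p.1, s)) (s := Ico (0 : ℝ) T ∩ Metric.ball t0 δ) ?_ ?_ hconv
      ⟨ht0, Metric.mem_ball_self hδ⟩ ⟨hp.2, hpb'.2⟩
    · intro s hs
      have := ((h2 p.1 hp.1).differentiableOn (by simp) s hs.1).hasDerivWithinAt
      exact this.mono inter_subset_left
    · intro s hs
      refine (hball ⟨?_, hp.1, hs.1⟩ : ‖F (p.1, s)‖ < B).le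
      rw [Metric.mem_ball, Prod.dist_eq, max_lt_iff]
      exact ⟨hpb'.1, hs.2⟩
  have := hd.add hsp
  simp only [sub_add_cancel, zero_add] at this
  exact this

lemma two_le_top' : (2 : WithTop ℕ∞) ≤ ((⊤ : ℕ∞) : WithTop ℕ∞) := by
  have h : ((2 : ℕ∞) : WithTop ℕ∞) ≤ ((⊤ : ℕ∞) : WithTop ℕ∞) := WithTop.coe_le_coe.2 le_top
  exact h

lemma slice_contDiffAt {Ω : Set (Cn n)} {a b : ℝ} {g : Cn n × ℝ → ℝ} (hΩ : IsOpen Ω)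
    (hg : ContDiffOn ℝ (⊤ : ℕ∞) g (Ω ×ˢ Ioo a b)) {z : Cn n} (hz : z ∈ Ω) {t : ℝ}
    (ht : t ∈ Ioo a b) :
    ContDiffAt ℝ 2 (fun w => g (w, t)) z ∧ DifferentiableAt ℝ (fun s => g (z, s)) t := by
  have h : ContDiffAt ℝ (⊤ : ℕ∞) g (z, t) :=
    hg.contDiffAt ((hΩ.prod isOpen_Ioo).mem_nhds ⟨hz, ht⟩)
  have h2 : ContDiffAt ℝ 2 g (z, t) := h.of_le two_le_top'
  constructor
  · exact ContDiffAt.comp (g := g) z h2 (contDiffAt_id.prodMk contDiffAt_const)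
  · have : ContDiffAt ℝ 2 (fun s => g (z, s)) t :=
      ContDiffAt.comp (g := g) t h2 (contDiffAt_const.prodMk contDiffAt_id)
    exact this.differentiableAt (by simp)

lemma phi_bounds {Ω : Set (Cn n)} {T C : ℝ} {φ : Cn n × ℝ → ℝ}
    (h : ∀ j l : ℕ, j + 2 * l ≤ 4 → ∀ z ∈ Ω, ∀ t ∈ Ioo (0 : ℝ) T,
    ‖iteratedFDeriv ℝ j (fun w => iteratedDeriv l (fun s => φ (w, s)) t) z‖ ≤ C)
    {z : Cn n} (hz : z ∈ Ω) {t : ℝ} (ht : t ∈ Ioo (0 : ℝ) T) :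
    |φ (z, t)| ≤ |C| ∧ ‖fderiv ℝ (fun w => φ (w, t)) z‖ ≤ |C| ∧
    ‖iteratedFDeriv ℝ 2 (fun w => φ (w, t)) z‖ ≤ |C| ∧ |deriv (fun s => φ (z, s)) t| ≤ |C| := by
  have h00 := h 0 0 (by norm_num) z hz t ht
  have h10 := h 1 0 (by norm_num) z hz t ht
  have h20 := h 2 0 (by norm_num) z hz t ht
  have h01 := h 0 1 (by norm_num) z hz t ht
  simp only [iteratedDeriv_zero, norm_iteratedFDeriv_zero, iteratedDeriv_one, Real.norm_eq_abs]
    at h00 h10 h20 h01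
  rw [norm_iteratedFDeriv_one] at h10
  exact ⟨h00.trans (le_abs_self C), h10.trans (le_abs_self C), h20.trans (le_abs_self C),
    h01.trans (le_abs_self C)⟩

lemma barrier_upper (hn : 0 < n) {Ω U : Set (Cn n)} {T Cu Cφv Cf : ℝ} {ρ : Cn n → ℝ}
    {u φ : Cn n × ℝ → ℝ} {f : ℝ × Cn n × ℝ → ℝ} (hΩ : IsOpen Ω) (hb : IsBounded Ω)
    (hU : IsOpen U) (hΩU : closure Ω ⊆ U) (hρ : ContDiffOn ℝ 2 ρ U)
    (hρ0 : ∀ z ∈ frontier Ω, ρ z = 0) {l M : ℝ}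
    (hl : ∀ z ∈ closure Ω, ∀ ξ : Cn n, l * ‖ξ‖ ^ 2 ≤ levi ρ z ξ) (hM0 : 0 ≤ M)
    (hM : 2 * |Cφv| < M * l) (H : AprioriHyps n Ω T Cu Cφv Cf u φ f)
    {t : ℝ} (ht : t ∈ Ioo 0 T) {z : Cn n} (hz : z ∈ Ω) : u (z, t) ≤ φ (z, t) - M * ρ z := by
  obtain ⟨Hφ, -, Hu, H21, Hpos, -, Hbd, -, -, -, Hφb⟩ := H
  by_contra! hcon
  have htI : t ∈ Ico 0 T := ⟨ht.1.le, ht.2⟩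
  have hφ' : ContDiffOn ℝ (⊤ : ℕ∞) φ (Ω ×ˢ Ioo 0 T) :=
    Hφ.mono (prod_mono subset_closure Ioo_subset_Ico_self)
  set W : Cn n → ℝ := fun w => 1 * u (w, t) + (-1) * φ (w, t) + M * ρ w + 0 with hW
  have hmaps : MapsTo (fun w : Cn n => (w, t)) (closure Ω) (closure Ω ×ˢ Ico 0 T) :=
    fun w hw => ⟨hw, htI⟩
  have cu : ContinuousOn (fun w => u (w, t)) (closure Ω) :=
    (u_cont H21).comp (by fun_prop) hmaps
  have cφ : ContinuousOn (fun w => φ (w, t)) (closure Ω) :=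
    Hφ.continuousOn.comp (by fun_prop) hmaps
  have cρ : ContinuousOn ρ (closure Ω) := hρ.continuousOn.mono hΩU
  have cW : ContinuousOn W (closure Ω) := by
    exact (((continuousOn_const.mul cu).add (continuousOn_const.mul cφ)).add
      (continuousOn_const.mul cρ)).add continuousOn_const
  obtain ⟨z1, hz1, hmax⟩ := hb.isCompact_closure.exists_isMaxOn ⟨z, subset_closure hz⟩ cW
  have hWz : 0 < W z1 := by
    have h1 : W z ≤ W z1 := hmax (subset_closure hz)
    have h2 : 0 < W z := by simp only [hW]; linarith
    linarith
  have hz1Ω : z1 ∈ Ω := by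
    by_contra hnot
    have hfr : z1 ∈ frontier Ω := by
      rw [hΩ.frontier_eq]; exact ⟨hz1, hnot⟩
    simp only [hW, Hbd z1 hfr t htI, hρ0 z1 hfr] at hWz
    linarith
  have hloc : IsLocalMax W z1 := by
    filter_upwards [hΩ.mem_nhds hz1Ω] with w hw
    exact hmax (subset_closure hw)
  have su := (slice_contDiffAt hΩ Hu hz1Ω ht).1
  have sφ := (slice_contDiffAt hΩ hφ' hz1Ω ht).1
  have sρ : ContDiffAt ℝ 2 ρ z1 := hρ.contDiffAt (hU.mem_nhds (hΩU hz1))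
  have sW : ContDiffAt ℝ 2 W z1 :=
    (((contDiffAt_const.mul su).add (contDiffAt_const.mul sφ)).add
      (contDiffAt_const.mul sρ)).add contDiffAt_const
  set ξ : Cn n := cvec n ⟨0, hn⟩ 1 with hξ
  have hξ1 : ‖ξ‖ = 1 := by simp [hξ, cvec]
  have hξ0 : ξ ≠ 0 := by
    intro h; rw [h] at hξ1; simp at hξ1
  have h1 := levi_nonpos sW hloc ξ
  rw [hW, levi_comb su sφ sρ] at h1
  have h2 := levi_pos su (Hpos t ht z1 hz1Ω) hξ0
  have h3 := abs_levi_le (phi_bounds Hφb hz1Ω ht).2.2.1 ξ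
  have h4 := hl z1 hz1 ξ
  rw [hξ1] at h3 h4
  have h5 := le_abs_self (levi (fun w => φ (w, t)) z1 ξ)
  have h6 := mul_le_mul_of_nonneg_left h4 hM0
  linarith

lemma barrier_lower (hn : 0 < n) {Ω U : Set (Cn n)} {T Cu Cφv Cf : ℝ} {ρ : Cn n → ℝ}
    {u φ : Cn n × ℝ → ℝ} {f : ℝ × Cn n × ℝ → ℝ} (hΩ : IsOpen Ω) (hb : IsBounded Ω)
    (hU : IsOpen U) (hΩU : closure Ω ⊆ U) (hρ : ContDiffOn ℝ 2 ρ U)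
    (hρ0 : ∀ z ∈ frontier Ω, ρ z = 0) (hρneg : ∀ z ∈ Ω, ρ z < 0) {l M S : ℝ}
    (hl : ∀ z ∈ closure Ω, ∀ ξ : Cn n, l * ‖ξ‖ ^ 2 ≤ levi ρ z ξ) (hM0 : 0 ≤ M)
    {t : ℝ} (ht : t ∈ Ioo 0 T) (hS0 : 0 ≤ S)
    (hS : |Cf| + |Cφv| + (|Cφv| + |Cu|) / t < S)
    (hM : 4 * Real.exp S + 2 * |Cφv| ≤ M * l) (H : AprioriHyps n Ω T Cu Cφv Cf u φ f)
    {z : Cn n} (hz : z ∈ Ω) : φ (z, t) + M * ρ z ≤ u (z, t) := by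
  obtain ⟨Hφ, -, Hu, H21, Hpos, Heq, Hbd, Hinit, -, Hf, Hφb⟩ := H
  by_contra! hcon
  obtain ⟨ht0, htT⟩ := ht
  have hφ' : ContDiffOn ℝ (⊤ : ℕ∞) φ (Ω ×ˢ Ioo 0 T) :=
    Hφ.mono (prod_mono subset_closure Ioo_subset_Ico_self)
  set K := |Cφv| + |Cu| with hK
  have hK0 : 0 ≤ K := by positivity
  set W : Cn n × ℝ → ℝ := fun p => (-1) * u p + 1 * φ p + M * ρ p.1 + (-K * (1 - p.2 / t)) with hW
  have hsub : closure Ω ×ˢ Icc 0 t ⊆ closure Ω ×ˢ Ico 0 T :=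
    prod_mono le_rfl fun s hs => ⟨hs.1, hs.2.trans_lt htT⟩
  have cu : ContinuousOn u (closure Ω ×ˢ Icc 0 t) := (u_cont H21).mono hsub
  have cφ : ContinuousOn φ (closure Ω ×ˢ Icc 0 t) := Hφ.continuousOn.mono hsub
  have cρ : ContinuousOn (fun p : Cn n × ℝ => ρ p.1) (closure Ω ×ˢ Icc 0 t) :=
    hρ.continuousOn.comp continuousOn_fst fun p hp => hΩU hp.1
  have cW : ContinuousOn W (closure Ω ×ˢ Icc 0 t) := by
    have c4 : Continuous (fun p : Cn n × ℝ => -K * (1 - p.2 / t)) := by fun_prop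
    exact (((continuousOn_const.mul cu).add (continuousOn_const.mul cφ)).add
      (continuousOn_const.mul cρ)).add c4.continuousOn
  have hmem : (z, t) ∈ closure Ω ×ˢ Icc 0 t := ⟨subset_closure hz, ht0.le, le_rfl⟩
  obtain ⟨⟨z1, t1⟩, ⟨hz1, ht1⟩, hmax⟩ :=
    (hb.isCompact_closure.prod isCompact_Icc).exists_isMaxOn ⟨_, hmem⟩ cW
  simp only at hz1 ht1
  have hWz : 0 < W (z1, t1) := by
    have h1 : W (z, t) ≤ W (z1, t1) := hmax hmem
    have h2 : 0 < W (z, t) := by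
      simp only [hW]
      rw [div_self ht0.ne']
      linarith
    linarith
  have ht1T : t1 ∈ Ico 0 T := ⟨ht1.1, ht1.2.trans_lt htT⟩
  have hfac : 0 ≤ K * (1 - t1 / t) := by
    have : t1 / t ≤ 1 := (div_le_one ht0).2 ht1.2
    exact mul_nonneg hK0 (by linarith)
  have hz1Ω : z1 ∈ Ω := by
    by_contra hnot
    have hfr : z1 ∈ frontier Ω := by
      rw [hΩ.frontier_eq]; exact ⟨hz1, hnot⟩
    simp only [hW, Hbd z1 hfr t1 ht1T, hρ0 z1 hfr] at hWz
    linarith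
  have ht1pos : 0 < t1 := by
    rcases ht1.1.eq_or_lt with h0 | h0
    · exfalso
      subst h0
      have h1 : φ (z1, 0) ≤ |Cφv| := by
        have hc : ContinuousWithinAt (fun s => φ (z1, s)) (Ico 0 T) 0 :=
          (Hφ.continuousOn.comp (g := φ) (f := fun s : ℝ => (z1, s)) (by fun_prop)
            (fun s hs => ⟨hz1, hs⟩)) 0 ht1T
        have hc2 : Tendsto (fun s => φ (z1, s)) (𝓝[>] 0) (𝓝 (φ (z1, 0))) := by
          have := hc.mono (Ioo_subset_Ico_self)
          rwa [ContinuousWithinAt, nhdsWithin_Ioo_eq_nhdsGT (ht0.trans htT)] at this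
        refine le_of_tendsto hc2 ?_
        filter_upwards [Ioo_mem_nhdsGT (ht0.trans htT)] with s hs
        exact (le_abs_self _).trans (phi_bounds Hφb hz1Ω hs).1
      have h2 := neg_le_of_abs_le (Hinit z1 hz1Ω)
      have h3 := le_abs_self Cu
      have h4 : M * ρ z1 ≤ 0 := mul_nonpos_of_nonneg_of_nonpos hM0 (hρneg z1 hz1Ω).le
      simp only [hW] at hWz
      rw [zero_div, sub_zero, mul_one] at hWz
      linarith
    · exact h0
  have ht1o : t1 ∈ Ioo 0 T := ⟨ht1pos, ht1T.2⟩
  obtain ⟨su, du⟩ := slice_contDiffAt hΩ Hu hz1Ω ht1o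
  obtain ⟨sφ, dφ⟩ := slice_contDiffAt hΩ hφ' hz1Ω ht1o
  have sρ : ContDiffAt ℝ 2 ρ z1 := hρ.contDiffAt (hU.mem_nhds (hΩU hz1))
  obtain ⟨-, -, hb2, hbt⟩ := phi_bounds Hφb hz1Ω ht1o
  -- the spatial inequality
  have hloc : IsLocalMax (fun w => W (w, t1)) z1 := by
    filter_upwards [hΩ.mem_nhds hz1Ω] with w hw
    exact hmax (show (w, t1) ∈ closure Ω ×ˢ Icc 0 t from ⟨subset_closure hw, ht1⟩)
  have sW : ContDiffAt ℝ 2 (fun w => W (w, t1)) z1 :=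
    (((contDiffAt_const.mul su).add (contDiffAt_const.mul sφ)).add
      (contDiffAt_const.mul sρ)).add (contDiffAt_const (c := -K * (1 - t1 / t)))
  have hlevi : ∀ ξ : Cn n, 4 * Real.exp S * ‖ξ‖ ^ 2 ≤ levi (fun w => u (w, t1)) z1 ξ := by
    intro ξ
    have h1 := levi_nonpos sW hloc ξ
    simp only [hW] at h1
    rw [levi_comb su sφ sρ] at h1
    have h3 := abs_levi_le hb2 ξ
    have h4 := hl z1 hz1 ξ
    have h5 := neg_abs_le (levi (fun w => φ (w, t1)) z1 ξ)
    have h6 := mul_le_mul_of_nonneg_left h4 hM0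
    have h7 := mul_le_mul_of_nonneg_right hM (sq_nonneg ‖ξ‖)
    linarith
  have hP := Hpos t1 ht1o z1 hz1Ω
  have hdet : Real.exp S ^ n ≤ (cHess (fun w => u (w, t1)) z1).det.re := by
    refine det_lower hP.isHermitian (Real.exp_pos S).le fun x => ?_
    rw [re_cHess su]
    have := hlevi (WithLp.toLp 2 (star (x : Fin n → ℂ)))
    have hnorm : ‖(WithLp.toLp 2 (star (x : Fin n → ℂ)) : Cn n)‖ = ‖x‖ := by
      simp [EuclideanSpace.norm_eq]
    rw [hnorm] at this
    linarith
  have hlog : S ≤ Real.log (cHess (fun w => u (w, t1)) z1).det.re := by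
    have h1 := Real.log_le_log (by positivity) hdet
    rw [Real.log_pow, Real.log_exp] at h1
    have h2 : (1 : ℝ) ≤ n := by exact_mod_cast hn
    nlinarith
  -- the time inequality
  have hd : HasDerivAt (fun s => W (z1, s))
      ((-1) * deriv (fun s => u (z1, s)) t1 + 1 * deriv (fun s => φ (z1, s)) t1 + K / t) t1 := by
    have h1 := ((du.hasDerivAt.const_mul (-1)).add (dφ.hasDerivAt.const_mul 1)).add_const (M * ρ z1)
    have h2 : HasDerivAt (fun s : ℝ => -K * (1 - s / t)) (-K * (-(1 / t))) t1 :=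
      (((hasDerivAt_id t1).div_const t).const_sub 1).const_mul (-K)
    have h3 := h1.add h2
    have e : K / t = -K * (-(1 / t)) := by ring
    rw [e]
    exact h3
  have hdn : 0 ≤ (-1) * deriv (fun s => u (z1, s)) t1 + 1 * deriv (fun s => φ (z1, s)) t1
      + K / t := by
    have hm : IsMaxOn (fun s => W (z1, s)) (Icc 0 t1) t1 := fun s hs =>
      hmax (show (z1, s) ∈ closure Ω ×ˢ Icc 0 t from ⟨hz1, hs.1, hs.2.trans ht1.2⟩)
    have hseg : segment ℝ t1 0 ⊆ Icc 0 t1 := by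
      rw [segment_symm, segment_eq_Icc ht1pos.le]
    have := hm.localize.hasFDerivWithinAt_nonpos hd.hasFDerivAt.hasFDerivWithinAt
      (sub_mem_posTangentConeAt_of_segment_subset hseg)
    simp at this
    by_contra! hneg
    nlinarith
  have hfb : |f (t1, z1, u (z1, t1))| ≤ |Cf| := by
    have := Hf 0 (by norm_num) (t1, z1, u (z1, t1)) ⟨ht1o, hz1Ω, mem_univ _⟩
    rw [norm_iteratedFDeriv_zero, Real.norm_eq_abs] at this
    exact this.trans (le_abs_self _)
  have h1 := Heq z1 hz1Ω t1 ht1o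
  have h2 := neg_le_of_abs_le hfb
  have h3 := le_of_abs_le hbt
  rw [h1] at hdn
  linarith

lemma boundary_deriv {Ω U : Set (Cn n)} {ρ g ψ : Cn n → ℝ} {C M : ℝ} (hC : 0 ≤ C) (hM : 0 ≤ M)
    (hU : IsOpen U) (hρ : ContDiffOn ℝ 2 ρ U) (hΩeq : Ω = {z ∈ U | ρ z < 0})
    {z0 : Cn n} (hz0c : z0 ∈ closure Ω) (hz0U : z0 ∈ U) (hρz : ρ z0 = 0)
    (hdρ : fderiv ℝ ρ z0 ≠ 0)
    (hg : DifferentiableWithinAt ℝ g (closure Ω) z0) (hgψ : g z0 = ψ z0)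
    (hψc : ContinuousOn ψ (closure Ω)) (hψd : ∀ z ∈ Ω, DifferentiableAt ℝ ψ z)
    (hψb : ∀ z ∈ Ω, ‖fderiv ℝ ψ z‖ ≤ C)
    (hb : ∀ z ∈ Ω, |g z - ψ z| ≤ M * |ρ z|) :
    ‖fderivWithin ℝ g (closure Ω) z0‖ ≤ C + M * ‖fderiv ℝ ρ z0‖ := by
  set D := fderivWithin ℝ g (closure Ω) z0 with hD
  set R := fderiv ℝ ρ z0 with hR
  have hRd : HasFDerivAt ρ R z0 :=
    ((hρ.contDiffAt (hU.mem_nhds hz0U)).differentiableAt (by simp)).hasFDerivAt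
  have key : ∀ v : Cn n, R v < 0 → |D v| ≤ C * ‖v‖ + M * |R v| := by
    intro v hv
    have hline : ∀ s : ℝ, HasDerivAt (fun s : ℝ => z0 + s • v) v s := by
      intro s
      simpa using ((hasDerivAt_id s).smul_const v).const_add z0
    have hlc : Continuous (fun s : ℝ => z0 + s • v) := by fun_prop
    have hρl : HasDerivAt (fun s : ℝ => ρ (z0 + s • v)) (R v) 0 := by
      refine HasFDerivAt.comp_hasDerivAt (0 : ℝ) ?_ (hline 0)
      simpa using hRd
    have hsl := hρl.tendsto_slope_zero_right
    simp only [zero_add, zero_smul, add_zero, hρz, sub_zero, smul_eq_mul] at hsl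
    have hin : ∀ᶠ s in 𝓝[>] (0 : ℝ), z0 + s • v ∈ Ω := by
      have hUe : ∀ᶠ s in 𝓝[>] (0 : ℝ), z0 + s • v ∈ U := by
        have : Tendsto (fun s : ℝ => z0 + s • v) (𝓝 0) (𝓝 z0) := by
          simpa using hlc.tendsto 0
        exact (this.mono_left nhdsWithin_le_nhds).eventually (hU.mem_nhds hz0U)
      filter_upwards [hUe, hsl.eventually_lt_const hv, self_mem_nhdsWithin] with s h1 h2 h3
      rw [hΩeq]
      refine ⟨h1, ?_⟩
      by_contra! h4
      have : 0 ≤ s⁻¹ * ρ (z0 + s • v) := mul_nonneg (inv_nonneg.2 (le_of_lt h3)) h4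
      linarith
    obtain ⟨ε, hε, hεs⟩ := mem_nhdsGT_iff_exists_Ioo_subset.1 hin
    have hlim : Tendsto (fun s : ℝ => s⁻¹ • (g (z0 + s • v) - g z0)) (𝓝[>] 0) (𝓝 (D v)) := by
      refine hg.hasFDerivWithinAt.lim (c := fun s : ℝ => s⁻¹) (d := fun s : ℝ => s • v) ?_ ?_ ?_
      · have : Continuous fun s : ℝ => s • v := by fun_prop
        have := this.tendsto 0
        rw [zero_smul] at this
        exact this.mono_left nhdsWithin_le_nhds
      · exact hin.mono fun s hs => subset_closure hs
      · refine tendsto_const_nhds.congr' ?_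
        filter_upwards [self_mem_nhdsWithin] with s hs
        rw [smul_smul, inv_mul_cancel₀ (ne_of_gt hs), one_smul]
    refine le_of_tendsto_of_tendsto hlim.abs ((hsl.abs.const_mul M).const_add (C * ‖v‖)) ?_
    filter_upwards [Ioo_mem_nhdsGT hε] with s hs
    have hs0 : 0 < s := hs.1
    have hsΩ : z0 + s • v ∈ Ω := hεs hs
    have hψ : |ψ (z0 + s • v) - ψ z0| ≤ C * ‖v‖ * s := by
      have hc : ContinuousOn (fun r : ℝ => ψ (z0 + r • v)) (Icc 0 s) := by
        refine hψc.comp hlc.continuousOn fun r hr => ?_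
        rcases hr.1.eq_or_lt with h | h
        · rw [← h]; simpa using hz0c
        · exact subset_closure (hεs ⟨h, hr.2.trans_lt hs.2⟩)
      have hder : ∀ r ∈ Ioo 0 s, HasDerivAt (fun r : ℝ => ψ (z0 + r • v))
          (fderiv ℝ ψ (z0 + r • v) v) r := by
        intro r hr
        exact (hψd _ (hεs ⟨hr.1, hr.2.trans hs.2⟩)).hasFDerivAt.comp_hasDerivAt r (hline r)
      obtain ⟨c, hc1, hc2⟩ := exists_hasDerivAt_eq_slope _ _ hs0 hc hder
      have hb1 : |fderiv ℝ ψ (z0 + c • v) v| ≤ C * ‖v‖ :=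
        ((fderiv ℝ ψ (z0 + c • v)).le_opNorm v).trans
          (mul_le_mul_of_nonneg_right (hψb _ (hεs ⟨hc1.1, hc1.2.trans hs.2⟩)) (norm_nonneg v))
      rw [hc2] at hb1
      simp only [zero_smul, add_zero, sub_zero] at hb1
      rwa [abs_div, abs_of_pos hs0, div_le_iff₀ hs0] at hb1
    have h1 := hb _ hsΩ
    have h2 : |g (z0 + s • v) - g z0| ≤ M * |ρ (z0 + s • v)| + C * ‖v‖ * s := by
      have : g (z0 + s • v) - g z0
          = (g (z0 + s • v) - ψ (z0 + s • v)) + (ψ (z0 + s • v) - ψ z0) := by rw [hgψ]; ring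
      rw [this]
      exact (abs_add_le _ _).trans (add_le_add h1 hψ)
    rw [smul_eq_mul, abs_mul, abs_mul, abs_of_pos (inv_pos.2 hs0), inv_mul_le_iff₀ hs0]
    refine h2.trans (le_of_eq ?_)
    field_simp
    ring
  have key2 : ∀ v : Cn n, R v ≠ 0 → |D v| ≤ C * ‖v‖ + M * |R v| := by
    intro v hv
    rcases hv.lt_or_gt with h | h
    · exact key v h
    · have := key (-v) (by simpa using h)
      simpa using this
  obtain ⟨e, he⟩ : ∃ e, R e ≠ 0 := by
    by_contra! h
    exact hdρ (ContinuousLinearMap.ext h)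
  have key3 : ∀ v : Cn n, |D v| ≤ C * ‖v‖ + M * |R v| := by
    intro v
    by_cases hv : R v = 0
    · have hcont : Continuous fun s : ℝ => v + s • e := by fun_prop
      have ht : Tendsto (fun s : ℝ => v + s • e) (𝓝[>] 0) (𝓝 v) := by
        have := hcont.tendsto 0
        rw [zero_smul, add_zero] at this
        exact this.mono_left nhdsWithin_le_nhds
      have c1 : Continuous fun w : Cn n => |D w| := D.continuous.abs
      have c2 : Continuous fun w : Cn n => C * ‖w‖ + M * |R w| :=
        (continuous_const.mul continuous_norm).add (continuous_const.mul R.continuous.abs)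
      refine le_of_tendsto_of_tendsto ((c1.tendsto v).comp ht) ((c2.tendsto v).comp ht) ?_
      filter_upwards [self_mem_nhdsWithin] with s hs
      refine key2 _ ?_
      rw [map_add, map_smul, hv, zero_add, smul_eq_mul]
      exact mul_ne_zero (ne_of_gt hs) he
    · exact key2 v hv
  refine ContinuousLinearMap.opNorm_le_bound _ (by positivity) fun v => ?_
  have h1 : |R v| ≤ ‖R‖ * ‖v‖ := R.le_opNorm v
  calc ‖D v‖ ≤ C * ‖v‖ + M * |R v| := key3 v
    _ ≤ C * ‖v‖ + M * (‖R‖ * ‖v‖) := by gcongr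
    _ = _ := by ring

/-- **Boundary gradient estimate** (Proposition 2.2): under the a priori hypotheses, for every
`m > 2/T` there is `C₃ > 0` depending only on `Ω, T, Cu, Cφv, Cf, m` such that
`|∇u| ≤ C₃` on `∂Ω×(2/m, T)`. -/
theorem stmt_8 (n : ℕ) (Ω : Set (Cn n)) (T Cu Cφv Cf m : ℝ)
    (hΩ : IsSPCDomain Ω) (hT : 0 < T) (hm : 2 / T < m) :
    ∃ C₃ : ℝ, 0 < C₃ ∧
      ∀ (u φ : Cn n × ℝ → ℝ) (f : ℝ × Cn n × ℝ → ℝ),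
        AprioriHyps n Ω T Cu Cφv Cf u φ f →
        ∀ z ∈ frontier Ω, ∀ t ∈ Ioo (2 / m) T,
          ‖fderivWithin ℝ (fun w => u (w, t)) (closure Ω) z‖ ≤ C₃ := by
  obtain ⟨hΩo, hΩne, hΩb, U, ρ, hU, -, hΩU, hρ', hpd, hΩeq, hdρ⟩ := hΩ
  have hρ : ContDiffOn ℝ 2 ρ U := hρ'.of_le two_le_top'
  have hK := hΩb.isCompact_closure
  rcases Nat.eq_zero_or_pos n with hn | hn
  · refine ⟨1, one_pos, ?_⟩
    intro u φ f _ z hz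
    exfalso
    subst hn
    have hsub : Subsingleton (Cn 0) := inferInstance
    have : Ω = univ := by
      obtain ⟨w, hw⟩ := hΩne
      exact eq_univ_of_forall fun y => by rw [Subsingleton.elim y w]; exact hw
    rw [this] at hz
    simp at hz
  obtain ⟨l, hl0, hl⟩ := levi_lower hU hK hΩU hρ hpd
  have hm0 : 0 < m := (by positivity : 0 < 2 / T).trans hm
  have hρneg : ∀ z ∈ Ω, ρ z < 0 := fun z hz => by
    rw [hΩeq] at hz; exact hz.2
  have hρ0 : ∀ z ∈ frontier Ω, ρ z = 0 := by
    intro z hz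
    have hzc : z ∈ closure Ω := frontier_subset_closure hz
    have hznot : z ∉ Ω := by
      rw [hΩo.frontier_eq] at hz; exact hz.2
    apply le_antisymm
    · have hc : ContinuousWithinAt ρ Ω z :=
        (hρ.continuousOn z (hΩU hzc)).mono (subset_closure.trans hΩU)
      exact hc.closure_le hzc continuousWithinAt_const fun y hy => (hρneg y hy).le
    · by_contra! h
      apply hznot
      rw [hΩeq]
      exact ⟨hΩU hzc, h⟩
  obtain ⟨B, hB⟩ : ∃ B, ∀ z ∈ closure Ω, ‖fderiv ℝ ρ z‖ ≤ B :=
    hK.exists_bound_of_continuousOn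
      ((hρ.continuousOn_fderiv_of_isOpen hU (by simp)).mono hΩU)
  set S := |Cf| + |Cφv| + (|Cφv| + |Cu|) * (m / 2) + 1 with hS
  have hS0 : 0 ≤ S := by positivity
  set M := (4 * Real.exp S + 2 * |Cφv|) / l with hM
  have hM0 : 0 ≤ M := by positivity
  have hMl : M * l = 4 * Real.exp S + 2 * |Cφv| := by
    rw [hM]; field_simp
  refine ⟨|Cφv| + M * |B| + 1, by positivity, ?_⟩
  intro u φ f H z hz t ht
  have hz' : z ∈ closure Ω := frontier_subset_closure hz
  have ht0 : 0 < t := (by positivity : 0 < 2 / m).trans ht.1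
  have hto : t ∈ Ioo 0 T := ⟨ht0, ht.2⟩
  have htI : t ∈ Ico 0 T := ⟨ht0.le, ht.2⟩
  have hSt : |Cf| + |Cφv| + (|Cφv| + |Cu|) / t < S := by
    have h1 : 1 / t ≤ m / 2 := by
      have := one_div_le_one_div_of_le (by positivity : 0 < 2 / m) ht.1.le
      rwa [one_div_div] at this
    have h2 : (|Cφv| + |Cu|) * (1 / t) ≤ (|Cφv| + |Cu|) * (m / 2) := by gcongr
    rw [mul_one_div] at h2
    linarith
  have hup : ∀ y ∈ Ω, u (y, t) ≤ φ (y, t) - M * ρ y := fun y hy =>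
    barrier_upper hn hΩo hΩb hU hΩU hρ hρ0 hl hM0
      (by have := Real.exp_pos S; linarith) H hto hy
  have hlo : ∀ y ∈ Ω, φ (y, t) + M * ρ y ≤ u (y, t) := fun y hy =>
    barrier_lower hn hΩo hΩb hU hΩU hρ hρ0 hρneg hl hM0 hto hS0 hSt hMl.ge H hy
  obtain ⟨Hφ, -, Hu, H21, Hpos, Heq, Hbd, Hinit, -, Hf, Hφb⟩ := H
  have hφ' : ContDiffOn ℝ (⊤ : ℕ∞) φ (Ω ×ˢ Ioo 0 T) :=
    Hφ.mono (prod_mono subset_closure Ioo_subset_Ico_self)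
  have hmain := boundary_deriv (g := fun w => u (w, t)) (ψ := fun w => φ (w, t)) (abs_nonneg Cφv) hM0
    hU hρ hΩeq hz' (hΩU hz') (hρ0 z hz) (hdρ z hz)
    ((H21.1 t htI).differentiableOn (by simp) z hz') (Hbd z hz t htI)
    (Hφ.continuousOn.comp (g := φ) (f := fun w : Cn n => (w, t)) (by fun_prop)
      (fun w hw => ⟨hw, htI⟩))
    (fun y hy => (slice_contDiffAt hΩo hφ' hy hto).1.differentiableAt (by simp))
    (fun y hy => (phi_bounds Hφb hy hto).2.1)
    (fun y hy => by
      have h1 := hup y hy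
      have h2 := hlo y hy
      rw [abs_of_neg (hρneg y hy), abs_le]
      constructor <;> linarith)
  have h3 : M * ‖fderiv ℝ ρ z‖ ≤ M * |B| := by
    gcongr
    exact (hB z hz').trans (le_abs_self B)
  linarith
end
end
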